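/- arXiv:1204.1503 — 4 statements merged into one kernel-verified Lean document; each statement's English description precedes it below -/
import Mathlib

section
/- Topological shadowing lemma for correctly aligned windows (Theorem 5.4, bi-infinite version, for windows with one-dimensional exit): Let M be a topological n-manifold with n = 1 + n₂, let {W_i}_{i∈ℤ} be a collection of (1,n₂)-windows in M, and let {f_i}_{i∈ℤ} be continuous maps on M such that for each i ∈ ℤ, W_i is correctly aligned with W_{i+1} under f_i with degree ±1. Then there exists a bi-infinite sequence of points {p_i}_{i∈ℤ} with p_i ∈ W_i and f_i(p_i) = p_{i+1} for all i ∈ ℤ; in particular there exists p ∈ W₀ with (f_i ∘ ⋯ ∘ f₀)(p) ∈ W_{i+1} for all i ≥ 0. -/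
open Set

noncomputable section

/-- The unit cube `[0,1] × [0,1]^{n₂}` in `ℝ × ℝ^{n₂}`. -/
def Cube (n₂ : ℕ) : Set (ℝ × (Fin n₂ → ℝ)) :=
  Set.Icc (0:ℝ) 1 ×ˢ Set.Icc (0 : Fin n₂ → ℝ) 1

/-- A `(1,n₂)`-window in `M`: the image of the unit cube under a homeomorphism `χ` from an
open neighborhood of the cube onto an open subset of `M`. -/
structure Window (M : Type) [TopologicalSpace M] (n₂ : ℕ) where
  χ : PartialHomeomorph (ℝ × (Fin n₂ → ℝ)) M
  cube_subset : Cube n₂ ⊆ χ.source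

variable {M : Type} [TopologicalSpace M] {n₂ : ℕ}

/-- The window itself: `χ([0,1] × [0,1]^{n₂})`. -/
def Window.carrier (W : Window M n₂) : Set M := W.χ '' Cube n₂

/-- The exit set of a window: `χ(∂[0,1] × [0,1]^{n₂})`. -/
def Window.exit (W : Window M n₂) : Set M :=
  W.χ '' (({0, 1} : Set ℝ) ×ˢ Set.Icc (0 : Fin n₂ → ℝ) 1)

/-- The entry set of a window: `χ([0,1] × ∂([0,1]^{n₂}))`. -/
def Window.entry (W : Window M n₂) : Set M :=
  W.χ '' (Set.Icc (0:ℝ) 1 ×ˢ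
    {y : Fin n₂ → ℝ | y ∈ Set.Icc (0 : Fin n₂ → ℝ) 1 ∧ ∃ i, y i = 0 ∨ y i = 1})

/-- `W₁` is correctly aligned with `W₂` under `f`, with degree `±1`. -/
def CorrectlyAligned (W₁ W₂ : Window M n₂) (f : M → M) : Prop :=
  Continuous f ∧
  f '' W₁.χ.target ⊆ W₂.χ.target ∧
  (f '' W₁.exit) ∩ W₂.carrier = ∅ ∧
  (f '' W₁.carrier) ∩ W₂.entry = ∅ ∧
  ∃ y₀ ∈ Set.Icc (0 : Fin n₂ → ℝ) 1,
    (∀ t ∈ Set.Icc (0:ℝ) 1, ∀ i, (W₂.χ.symm (f (W₁.χ (t, y₀)))).2 i ∈ Set.Ioo (0:ℝ) 1) ∧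
    (((W₂.χ.symm (f (W₁.χ (0, y₀)))).1 < 0 ∧ 1 < (W₂.χ.symm (f (W₁.χ (1, y₀)))).1) ∨
     ((W₂.χ.symm (f (W₁.χ (1, y₀)))).1 < 0 ∧ 1 < (W₂.χ.symm (f (W₁.χ (0, y₀)))).1))

/-- A continuous self-map of `ℝ × ℝ^{n₂}`, thought of as an extension of a map defined on the unit
cube, that satisfies the coordinate version of correct alignment with degree `±1`. -/
structure AlignedMap {n₂ : ℕ} (F : ℝ × (Fin n₂ → ℝ) → ℝ × (Fin n₂ → ℝ)) : Prop where
  continuous : Continuous F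
  entry : ∀ x, F x ∈ Cube n₂ → ∀ i, (F x).2 i ∈ Ioo (0 : ℝ) 1
  exit : ∀ x, x.1 = 0 ∨ x.1 = 1 → F x ∉ Cube n₂
  degree : ∃ y₀, (∀ t ∈ Icc (0 : ℝ) 1, ∀ i, (F (t, y₀)).2 i ∈ Ioo (0 : ℝ) 1) ∧
    (((F (0, y₀)).1 < 0 ∧ 1 < (F (1, y₀)).1) ∨ ((F (1, y₀)).1 < 0 ∧ 1 < (F (0, y₀)).1))

/-- The curve `γ` stays in the unit cube on `[a, b]` and joins its two exit faces. -/
def CrossesCube {n₂ : ℕ} (γ : ℝ → ℝ × (Fin n₂ → ℝ)) (a b : ℝ) : Prop :=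
  a ≤ b ∧ (∀ x ∈ Icc a b, γ x ∈ Cube n₂) ∧
    (((γ a).1 = 0 ∧ (γ b).1 = 1) ∨ ((γ a).1 = 1 ∧ (γ b).1 = 0))

theorem isClosed_cube (n₂ : ℕ) : IsClosed (Cube n₂) := isClosed_Icc.prod isClosed_Icc

theorem isCompact_cube (n₂ : ℕ) : IsCompact (Cube n₂) := isCompact_Icc.prod isCompact_Icc

theorem mem_cube_iff {n₂ : ℕ} {z : ℝ × (Fin n₂ → ℝ)} :
    z ∈ Cube n₂ ↔ z.1 ∈ Icc (0 : ℝ) 1 ∧ ∀ i, z.2 i ∈ Icc (0 : ℝ) 1 := by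
  simp only [Cube, mem_prod, mem_Icc, Pi.le_def, Pi.zero_apply, Pi.one_apply, forall_and]

theorem IsPreconnected.constant_of_forall_eq_intCast {α : Type*} [TopologicalSpace α] {s : Set α}
    (hs : IsPreconnected s) {f : α → ℝ} (hf : ContinuousOn f s)
    (hint : ∀ x ∈ s, ∃ n : ℤ, f x = n) {x y : α} (hx : x ∈ s) (hy : y ∈ s) : f x = f y := by
  refine hs.constant_of_mapsTo (T := range ((↑) : ℤ → ℝ)) ?_ hf ?_ hx hy
  · rw [isDiscrete_iff_discreteTopology]
    exact Int.isClosedEmbedding_coe_real.isEmbedding.toHomeomorph.symm.isEmbedding.discreteTopology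
  · intro z hz
    obtain ⟨n, hn⟩ := hint z hz
    exact ⟨n, hn.symm⟩

/-- The projection of the first coordinate to the circle, collapsing the complement of the cube
to the base point. -/
def cubeCollapse {n₂ : ℕ} (z : ℝ × (Fin n₂ → ℝ)) : AddCircle (1 : ℝ) :=
  open Classical in if z ∈ Cube n₂ then (z.1 : AddCircle (1 : ℝ)) else 0

theorem cubeCollapse_of_mem {n₂ : ℕ} {z : ℝ × (Fin n₂ → ℝ)} (hz : z ∈ Cube n₂) :
    cubeCollapse z = (z.1 : AddCircle (1 : ℝ)) := if_pos hz

theorem cubeCollapse_of_notMem {n₂ : ℕ} {z : ℝ × (Fin n₂ → ℝ)} (hz : z ∉ Cube n₂) :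
    cubeCollapse z = 0 := if_neg hz

theorem cubeCollapse_of_mem_Ioo {n₂ : ℕ} {z : ℝ × (Fin n₂ → ℝ)}
    (hz : ∀ i, z.2 i ∈ Ioo (0 : ℝ) 1) :
    cubeCollapse z = ((max 0 (min 1 z.1) : ℝ) : AddCircle (1 : ℝ)) := by
  by_cases h : z.1 ∈ Icc (0 : ℝ) 1
  · rw [cubeCollapse_of_mem (mem_cube_iff.2 ⟨h, fun i => Ioo_subset_Icc_self (hz i)⟩),
      min_eq_right h.2, max_eq_right h.1]
  · rw [cubeCollapse_of_notMem fun h' => h (mem_cube_iff.1 h').1]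
    rcases lt_or_ge z.1 0 with h0 | h0
    · rw [max_eq_left ((min_le_right _ _).trans h0.le), AddCircle.coe_zero]
    · have h1 : 1 < z.1 := by
        by_contra! h1
        exact h ⟨h0, h1⟩
      rw [min_eq_left h1.le, max_eq_right zero_le_one, AddCircle.coe_period]

theorem continuousAt_cubeCollapse {n₂ : ℕ} {z : ℝ × (Fin n₂ → ℝ)}
    (hz : z ∈ Cube n₂ → ∀ i, z.2 i ∈ Ioo (0 : ℝ) 1) : ContinuousAt cubeCollapse z := by
  by_cases h : z ∈ Cube n₂
  · have hopen : IsOpen {w : ℝ × (Fin n₂ → ℝ) | ∀ i, w.2 i ∈ Ioo (0 : ℝ) 1} := by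
      simp only [ofPred_forall]
      exact isOpen_iInter_of_finite fun i => isOpen_Ioo.preimage (by fun_prop)
    have hcont : Continuous fun w : ℝ × (Fin n₂ → ℝ) =>
        ((max 0 (min 1 w.1) : ℝ) : AddCircle (1 : ℝ)) :=
      (AddCircle.continuous_mk' 1).comp (by fun_prop)
    refine hcont.continuousAt.congr ?_
    filter_upwards [hopen.mem_nhds (hz h)] with w hw
    exact (cubeCollapse_of_mem_Ioo hw).symm
  · refine (continuousAt_const (y := (0 : AddCircle (1 : ℝ)))).congr ?_
    filter_upwards [(isClosed_cube n₂).isOpen_compl.mem_nhds h] with w hw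
    exact (cubeCollapse_of_notMem hw).symm

theorem AddCircle.exists_eq_add_intCast_of_coe_eq {x y : ℝ}
    (h : (x : AddCircle (1 : ℝ)) = y) : ∃ n : ℤ, x = y + n := by
  obtain ⟨n, hn⟩ := AddCircle.coe_eq_zero_iff (p := (1 : ℝ)) |>.1
    (show ((x - y : ℝ) : AddCircle (1 : ℝ)) = 0 by rw [AddCircle.coe_sub, h, sub_self])
  refine ⟨n, ?_⟩
  rw [zsmul_one] at hn
  linarith

/-- The collapsing map lifts along an aligned map, and the lift increases by `±1` from one exit
face to the other. -/
theorem AlignedMap.exists_lift {n₂ : ℕ} {F : ℝ × (Fin n₂ → ℝ) → ℝ × (Fin n₂ → ℝ)}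
    (hF : AlignedMap F) :
    ∃ g : ℝ × (Fin n₂ → ℝ) → ℝ, Continuous g ∧
      (∀ x, (g x : AddCircle (1 : ℝ)) = cubeCollapse (F x)) ∧
      ∃ a b : ℤ, (b = a + 1 ∨ a = b + 1) ∧ (∀ y, g (0, y) = a) ∧ ∀ y, g (1, y) = b := by
  have hc : Continuous fun x => cubeCollapse (F x) := continuous_iff_continuousAt.2 fun x =>
    (continuousAt_cubeCollapse (hF.entry x)).comp hF.continuous.continuousAt
  obtain ⟨e₀, he₀⟩ := QuotientAddGroup.mk_surjective (cubeCollapse (F 0))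
  obtain ⟨g, ⟨-, hg⟩, -⟩ := (AddCircle.isCoveringMap_coe (1 : ℝ)).existsUnique_continuousMap_lifts
    ⟨_, hc⟩ 0 e₀ he₀
  have hg' : ∀ x, (g x : AddCircle (1 : ℝ)) = cubeCollapse (F x) := fun x => congrFun hg x
  have hint : ∀ x, x.1 = 0 ∨ x.1 = 1 → ∃ n : ℤ, g x = n := fun x hx => by
    have h := hg' x
    rw [cubeCollapse_of_notMem (hF.exit x hx)] at h
    simpa using AddCircle.exists_eq_add_intCast_of_coe_eq (y := 0) (by simpa using h)
  have hface : ∀ s : ℝ, s = 0 ∨ s = 1 → ∀ y y', g (s, y) = g (s, y') := fun s hs y y' =>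
    isPreconnected_univ.constant_of_forall_eq_intCast (f := fun y => g (s, y))
      (by fun_prop) (fun y _ => hint (s, y) hs) (mem_univ y) (mem_univ y')
  obtain ⟨y₀, hy₀, hdeg⟩ := hF.degree
  obtain ⟨a, ha⟩ := hint (0, y₀) (.inl rfl)
  obtain ⟨b, hb⟩ := hint (1, y₀) (.inr rfl)
  refine ⟨g, g.continuous, hg', a, b, ?_, fun y => (hface 0 (.inl rfl) y y₀).trans ha,
    fun y => (hface 1 (.inr rfl) y y₀).trans hb⟩
  have hFc := hF.continuous
  have hconst := isPreconnected_Icc.constant_of_forall_eq_intCast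
    (f := fun t : ℝ => g (t, y₀) - max 0 (min 1 (F (t, y₀)).1)) (s := Icc (0 : ℝ) 1)
    (by fun_prop) (fun t ht => by
      have h := hg' (t, y₀)
      rw [cubeCollapse_of_mem_Ioo (hy₀ t ht)] at h
      obtain ⟨n, hn⟩ := AddCircle.exists_eq_add_intCast_of_coe_eq h
      exact ⟨n, by rw [hn]; ring⟩)
    (left_mem_Icc.2 zero_le_one) (right_mem_Icc.2 zero_le_one)
  simp only [ha, hb] at hconst
  have hneg : ∀ r : ℝ, r < 0 → max 0 (min 1 r) = 0 := fun r hr =>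
    max_eq_left ((min_le_right _ _).trans hr.le)
  have hbig : ∀ r : ℝ, 1 < r → max 0 (min 1 r) = 1 := fun r hr => by
    rw [min_eq_left hr.le, max_eq_right zero_le_one]
  rcases hdeg with ⟨h0, h1⟩ | ⟨h1, h0⟩
  · rw [hneg _ h0, hbig _ h1] at hconst
    left
    exact_mod_cast (by linarith : (b : ℝ) = a + 1)
  · rw [hneg _ h1, hbig _ h0] at hconst
    right
    exact_mod_cast (by linarith : (a : ℝ) = b + 1)

theorem exists_Ioo_subset_preimage_of_lt {h : ℝ → ℝ} (hc : Continuous h) {a b : ℝ} (hab : a ≤ b)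
    (hlt : h a < h b) :
    ∃ s t, a ≤ s ∧ s < t ∧ t ≤ b ∧ h s = h a ∧ h t = h b ∧
      ∀ x ∈ Ioo s t, h x ∈ Ioo (h a) (h b) := by
  obtain ⟨t, ⟨⟨hat, htb⟩, ht⟩, htmin⟩ :=
    (isCompact_Icc.inter_right (isClosed_singleton.preimage hc) :
      IsCompact (Icc a b ∩ h ⁻¹' {h b})).exists_isLeast ⟨b, ⟨hab, le_rfl⟩, rfl⟩
  obtain ⟨s, ⟨⟨has, hst⟩, hs⟩, hsmax⟩ :=
    (isCompact_Icc.inter_right (isClosed_singleton.preimage hc) :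
      IsCompact (Icc a t ∩ h ⁻¹' {h a})).exists_isGreatest ⟨a, ⟨le_rfl, hat⟩, rfl⟩
  simp only [mem_preimage, mem_singleton_iff] at hs ht
  have hst' : s < t := hst.lt_of_ne fun h' => by
    rw [h', ht] at hs
    exact hlt.ne' hs
  refine ⟨s, t, has, hst', htb, hs, ht, fun x ⟨hsx, hxt⟩ => ⟨?_, ?_⟩⟩
  · by_contra! hx
    obtain ⟨y, hy, hya⟩ := intermediate_value_Icc hxt.le hc.continuousOn
      (show h a ∈ Icc (h x) (h t) from ⟨hx, ht ▸ hlt.le⟩)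
    exact absurd (hsmax ⟨⟨has.trans (hsx.le.trans hy.1), hy.2⟩, hya⟩)
      (not_le.2 (hsx.trans_le hy.1))
  · by_contra! hx
    obtain ⟨y, hy, hyb⟩ := intermediate_value_Icc hsx.le hc.continuousOn
      (show h b ∈ Icc (h s) (h x) from ⟨hs ▸ hlt.le, hx⟩)
    exact absurd (htmin ⟨⟨has.trans hy.1, hy.2.trans (hxt.le.trans htb)⟩, hyb⟩)
      (not_le.2 (hy.2.trans_lt hxt))

/-- If a lift of the collapsed curve runs through a unit interval with integer endpoints, then the
curve crosses the cube. -/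
theorem crossesCube_of_lift {n₂ : ℕ} {γ : ℝ → ℝ × (Fin n₂ → ℝ)} (hγ : Continuous γ)
    {h : ℝ → ℝ} (hh : Continuous h)
    (hlift : ∀ x, (h x : AddCircle (1 : ℝ)) = cubeCollapse (γ x)) {k : ℤ} {s t : ℝ} (hst : s < t)
    (hends : (h s = k ∧ h t = k + 1) ∨ (h s = k + 1 ∧ h t = k))
    (hmem : ∀ x ∈ Ioo s t, h x ∈ Ioo (k : ℝ) (k + 1)) : CrossesCube γ s t := by
  have hopen : ∀ x ∈ Ioo s t, γ x ∈ Cube n₂ ∧ (γ x).1 = h x - k := fun x hx => by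
    obtain ⟨hk, hk'⟩ := hmem x hx
    have hx' := hlift x
    have hcube : γ x ∈ Cube n₂ := by
      by_contra hn
      rw [cubeCollapse_of_notMem hn, ← AddCircle.coe_zero] at hx'
      obtain ⟨m, hm⟩ := AddCircle.exists_eq_add_intCast_of_coe_eq hx'
      rw [hm, zero_add] at hk hk'
      have h1 : k < m := by exact_mod_cast hk
      have h2 : m < k + 1 := by exact_mod_cast hk'
      omega
    rw [cubeCollapse_of_mem hcube] at hx'
    obtain ⟨m, hm⟩ := AddCircle.exists_eq_add_intCast_of_coe_eq hx'
    obtain ⟨h0, h1⟩ := (mem_cube_iff.1 hcube).1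
    have hlo : k < m + 1 := by exact_mod_cast (by linarith : (k : ℝ) < m + 1)
    have hhi : m < k + 1 := by exact_mod_cast (by linarith : (m : ℝ) < k + 1)
    obtain rfl : m = k := by omega
    exact ⟨hcube, by linarith⟩
  have hclosed : ∀ x ∈ Icc s t, γ x ∈ Cube n₂ ∧ (γ x).1 = h x - k := by
    have hcl : IsClosed {x | γ x ∈ Cube n₂ ∧ (γ x).1 = h x - k} :=
      ((isClosed_cube n₂).preimage hγ).inter (isClosed_eq (by fun_prop) (by fun_prop))
    rw [← closure_Ioo hst.ne]
    exact closure_minimal hopen hcl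
  have hs := (hclosed s (left_mem_Icc.2 hst.le)).2
  have ht := (hclosed t (right_mem_Icc.2 hst.le)).2
  refine ⟨hst.le, fun x hx => (hclosed x hx).1, ?_⟩
  rcases hends with ⟨h1, h2⟩ | ⟨h1, h2⟩
  · exact .inl ⟨by rw [hs, h1]; ring, by rw [ht, h2]; ring⟩
  · exact .inr ⟨by rw [hs, h1]; ring, by rw [ht, h2]; ring⟩

theorem CrossesCube.exists_subinterval {n₂ : ℕ} {γ : ℝ → ℝ × (Fin n₂ → ℝ)} (hγ : Continuous γ)
    {F : ℝ × (Fin n₂ → ℝ) → ℝ × (Fin n₂ → ℝ)} (hF : AlignedMap F) {a b : ℝ}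
    (hab : CrossesCube γ a b) : ∃ s t, a ≤ s ∧ t ≤ b ∧ CrossesCube (F ∘ γ) s t := by
  obtain ⟨g, hg, hlift, p, q, hpq, hp, hq⟩ := hF.exists_lift
  have hFγ : Continuous (F ∘ γ) := hF.continuous.comp hγ
  have hgγ : Continuous (g ∘ γ) := hg.comp hγ
  have hp' : ∀ x, (γ x).1 = 0 → (g ∘ γ) x = p := fun x hx => by
    rw [← hp (γ x).2, ← hx, Function.comp_apply]
  have hq' : ∀ x, (γ x).1 = 1 → (g ∘ γ) x = q := fun x hx => by
    rw [← hq (γ x).2, ← hx, Function.comp_apply]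
  have hends : ∃ k : ℤ, ((g ∘ γ) a = k ∧ (g ∘ γ) b = k + 1) ∨
      ((g ∘ γ) a = k + 1 ∧ (g ∘ γ) b = k) := by
    rcases hab.2.2 with ⟨ha, hb⟩ | ⟨ha, hb⟩ <;> rcases hpq with rfl | rfl
    · exact ⟨p, .inl ⟨hp' a ha, by rw [hq' b hb]; push_cast; rfl⟩⟩
    · exact ⟨q, .inr ⟨by rw [hp' a ha]; push_cast; rfl, hq' b hb⟩⟩
    · exact ⟨p, .inr ⟨by rw [hq' a ha]; push_cast; rfl, hp' b hb⟩⟩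
    · exact ⟨q, .inl ⟨hq' a ha, by rw [hp' b hb]; push_cast; rfl⟩⟩
  obtain ⟨k, ⟨ha, hb⟩ | ⟨ha, hb⟩⟩ := hends
  · obtain ⟨s, t, has, hst, htb, hs, ht, hmem⟩ :=
      exists_Ioo_subset_preimage_of_lt hgγ hab.1 (by rw [ha, hb]; linarith)
    rw [ha, hb] at hmem
    exact ⟨s, t, has, htb, crossesCube_of_lift hFγ hgγ (fun x => hlift (γ x)) hst
      (.inl ⟨hs.trans ha, ht.trans hb⟩) hmem⟩
  · obtain ⟨s, t, has, hst, htb, hs, ht, hmem⟩ :=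
      exists_Ioo_subset_preimage_of_lt hgγ.neg hab.1
        (by rw [Pi.neg_apply, Pi.neg_apply, ha, hb]; linarith)
    simp only [Pi.neg_apply, neg_inj] at hs ht hmem
    refine ⟨s, t, has, htb, crossesCube_of_lift hFγ hgγ (fun x => hlift (γ x)) hst
      (.inr ⟨hs.trans ha, ht.trans hb⟩) fun x hx => ?_⟩
    obtain ⟨h1, h2⟩ := hmem x hx
    rw [ha] at h1
    rw [hb] at h2
    exact ⟨neg_lt_neg_iff.1 h2, neg_lt_neg_iff.1 h1⟩

/-- Every finite composition of aligned maps has an orbit in the cube. -/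
theorem AlignedMap.exists_orbit {n₂ : ℕ}
    {F : ℕ → ℝ × (Fin n₂ → ℝ) → ℝ × (Fin n₂ → ℝ)} (hF : ∀ k, AlignedMap (F k)) (N : ℕ) :
    ∃ z : ℕ → ℝ × (Fin n₂ → ℝ), (∀ k, z (k + 1) = F k (z k)) ∧ ∀ k ≤ N, z k ∈ Cube n₂ := by
  let γ : ℕ → ℝ → ℝ × (Fin n₂ → ℝ) := fun k =>
    Nat.rec (fun t => (t, 0)) (fun k c => F k ∘ c) k
  have hγ : ∀ k, Continuous (γ k) := fun k => by
    induction k with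
    | zero => exact Continuous.prodMk_left 0
    | succ k ih => exact (hF k).continuous.comp ih
  have key : ∀ k, ∃ s t, CrossesCube (γ k) s t ∧ ∀ j ≤ k, ∀ x ∈ Icc s t, γ j x ∈ Cube n₂ := by
    intro k
    induction k with
    | zero =>
      have h0 : ∀ x ∈ Icc (0 : ℝ) 1, γ 0 x ∈ Cube n₂ := fun x hx =>
        mem_cube_iff.2 ⟨hx, fun i => ⟨le_rfl, zero_le_one⟩⟩
      refine ⟨0, 1, ⟨zero_le_one, h0, .inl ⟨rfl, rfl⟩⟩, fun j hj => ?_⟩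
      obtain rfl : j = 0 := by omega
      exact h0
    | succ k ih =>
      obtain ⟨a, b, hab, hmem⟩ := ih
      obtain ⟨s, t, has, htb, hst⟩ := hab.exists_subinterval (hγ k) (hF k)
      refine ⟨s, t, hst, fun j hj x hx => ?_⟩
      rcases hj.lt_or_eq with hj | rfl
      · exact hmem j (by omega) x ⟨has.trans hx.1, hx.2.trans htb⟩
      · exact hst.2.1 x hx
  obtain ⟨s, t, hst, hmem⟩ := key N
  exact ⟨fun k => γ k s, fun k => rfl, fun k hk => hmem k hk s (left_mem_Icc.2 hst.1)⟩

/-- The retraction of `ℝ × ℝ^{n₂}` onto the unit cube. -/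
def cubeRetraction {n₂ : ℕ} (z : ℝ × (Fin n₂ → ℝ)) : ℝ × (Fin n₂ → ℝ) :=
  (max 0 (min 1 z.1), fun i => max 0 (min 1 (z.2 i)))

theorem continuous_cubeRetraction {n₂ : ℕ} :
    Continuous (cubeRetraction : ℝ × (Fin n₂ → ℝ) → ℝ × (Fin n₂ → ℝ)) := by
  unfold cubeRetraction
  fun_prop

theorem cubeRetraction_mem {n₂ : ℕ} (z : ℝ × (Fin n₂ → ℝ)) : cubeRetraction z ∈ Cube n₂ := by
  have h : ∀ r : ℝ, max 0 (min 1 r) ∈ Icc (0 : ℝ) 1 := fun r =>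
    ⟨le_max_left _ _, max_le zero_le_one (min_le_left _ _)⟩
  exact mem_cube_iff.2 ⟨h _, fun i => h _⟩

theorem cubeRetraction_of_mem {n₂ : ℕ} {z : ℝ × (Fin n₂ → ℝ)} (hz : z ∈ Cube n₂) :
    cubeRetraction z = z := by
  have h : ∀ r : ℝ, r ∈ Icc (0 : ℝ) 1 → max 0 (min 1 r) = r := fun r hr => by
    rw [min_eq_right hr.2, max_eq_right hr.1]
  obtain ⟨h1, h2⟩ := mem_cube_iff.1 hz
  exact Prod.ext (h _ h1) (funext fun i => h _ (h2 i))

/-- The map `f` in the coordinates of two windows, extended from the cube to the whole space. -/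
def Window.coordMap {M : Type} [TopologicalSpace M] {n₂ : ℕ} (W₁ W₂ : Window M n₂) (f : M → M)
    (z : ℝ × (Fin n₂ → ℝ)) : ℝ × (Fin n₂ → ℝ) :=
  W₂.χ.symm (f (W₁.χ (cubeRetraction z)))

theorem CorrectlyAligned.mem_target {M : Type} [TopologicalSpace M] {n₂ : ℕ} {W₁ W₂ : Window M n₂}
    {f : M → M} (h : CorrectlyAligned W₁ W₂ f) {z : ℝ × (Fin n₂ → ℝ)} (hz : z ∈ Cube n₂) :
    f (W₁.χ z) ∈ W₂.χ.target :=
  h.2.1 (mem_image_of_mem f (W₁.χ.map_source (W₁.cube_subset hz)))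

theorem CorrectlyAligned.map_chart {M : Type} [TopologicalSpace M] {n₂ : ℕ} {W₁ W₂ : Window M n₂}
    {f : M → M} (h : CorrectlyAligned W₁ W₂ f) {z : ℝ × (Fin n₂ → ℝ)} (hz : z ∈ Cube n₂) :
    W₂.χ (W₁.coordMap W₂ f z) = f (W₁.χ z) := by
  rw [Window.coordMap, cubeRetraction_of_mem hz, W₂.χ.right_inv (h.mem_target hz)]

theorem CorrectlyAligned.alignedMap {M : Type} [TopologicalSpace M] {n₂ : ℕ}
    {W₁ W₂ : Window M n₂} {f : M → M} (h : CorrectlyAligned W₁ W₂ f) :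
    AlignedMap (W₁.coordMap W₂ f) := by
  have hmap : ∀ z, W₂.χ (W₁.coordMap W₂ f z) = f (W₁.χ (cubeRetraction z)) := fun z =>
    W₂.χ.right_inv (h.mem_target (cubeRetraction_mem z))
  have hmem : ∀ t ∈ Icc (0 : ℝ) 1, ∀ y ∈ Icc (0 : Fin n₂ → ℝ) 1,
      W₁.coordMap W₂ f (t, y) = W₂.χ.symm (f (W₁.χ (t, y))) := fun t ht y hy => by
    rw [Window.coordMap, cubeRetraction_of_mem (mk_mem_prod ht hy)]
  obtain ⟨hf, -, hexit, hentry, y₀, hy₀, hcurve, hdeg⟩ := id h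
  refine ⟨?_, fun x hx i => ?_, fun x hx hx' => ?_, y₀, fun t ht => ?_, ?_⟩
  · exact W₂.χ.continuousOn_symm.comp_continuous
      (hf.comp (W₁.χ.continuousOn.comp_continuous continuous_cubeRetraction
        fun z => W₁.cube_subset (cubeRetraction_mem z)))
      fun z => h.mem_target (cubeRetraction_mem z)
  · have hx' := (mem_cube_iff.1 hx).2 i
    have hne : ¬((W₁.coordMap W₂ f x).2 i = 0 ∨ (W₁.coordMap W₂ f x).2 i = 1) := fun hi =>
      eq_empty_iff_forall_notMem.1 hentry (W₂.χ (W₁.coordMap W₂ f x))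
        ⟨⟨_, mem_image_of_mem _ (cubeRetraction_mem x), (hmap x).symm⟩,
          mem_image_of_mem _ ⟨hx.1, hx.2, i, hi⟩⟩
    push Not at hne
    exact ⟨hx'.1.lt_of_ne hne.1.symm, hx'.2.lt_of_ne hne.2⟩
  · refine eq_empty_iff_forall_notMem.1 hexit (W₂.χ (W₁.coordMap W₂ f x))
      ⟨⟨_, mem_image_of_mem _ ⟨?_, (cubeRetraction_mem x).2⟩, (hmap x).symm⟩,
        mem_image_of_mem _ hx'⟩
    rcases hx with hx | hx <;> simp [cubeRetraction, hx]
  · rw [hmem t ht y₀ hy₀]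
    exact hcurve t ht
  · rwa [hmem 0 (left_mem_Icc.2 zero_le_one) y₀ hy₀, hmem 1 (right_mem_Icc.2 zero_le_one) y₀ hy₀]

theorem Window.isCompact_carrier {M : Type} [TopologicalSpace M] {n₂ : ℕ} (W : Window M n₂) :
    IsCompact W.carrier :=
  (isCompact_cube n₂).image_of_continuousOn (W.χ.continuousOn.mono W.cube_subset)

/-- **Topological shadowing lemma for correctly aligned windows** (Theorem 5.4,
bi-infinite version, for windows with one-dimensional exit): if each `(1,n₂)`-window
`W i` in the topological `(1+n₂)`-manifold `M` is correctly aligned with `W (i+1)` under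
`f i` (with degree `±1`), then there is a bi-infinite orbit `p i` with `p i ∈ W i` and
`f i (p i) = p (i+1)` for all `i ∈ ℤ`. -/
theorem shadowing_biinfinite {n₂ : ℕ} (hn₂ : 1 ≤ n₂)
    {M : Type} [TopologicalSpace M] [T2Space M]
    [ChartedSpace (ℝ × (Fin n₂ → ℝ)) M]
    (Ws : ℤ → Window M n₂) (fs : ℤ → M → M)
    (halign : ∀ i : ℤ, CorrectlyAligned (Ws i) (Ws (i + 1)) (fs i)) :
    ∃ p : ℤ → M, (∀ i : ℤ, p i ∈ (Ws i).carrier) ∧ ∀ i : ℤ, fs i (p i) = p (i + 1) := by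
  let K : ℕ → Set (ℤ → M) := fun N =>
    univ.pi (fun i => (Ws i).carrier) ∩
      {p | ∀ i : ℤ, -(N : ℤ) ≤ i → i < N → fs i (p i) = p (i + 1)}
  have hclosed : ∀ N, IsClosed {p : ℤ → M | ∀ i : ℤ, -(N : ℤ) ≤ i → i < N →
      fs i (p i) = p (i + 1)} := fun N => by
    simp only [ofPred_forall]
    exact isClosed_iInter fun i => isClosed_iInter fun _ => isClosed_iInter fun _ =>
      isClosed_eq ((halign i).1.comp (continuous_apply i)) (continuous_apply (i + 1))
  have hcompact : ∀ N, IsCompact (K N) := fun N =>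
    (isCompact_univ_pi fun i => (Ws i).isCompact_carrier).inter_right (hclosed N)
  have hne : ∀ N, (K N).Nonempty := fun N => by
    obtain ⟨z, hz, hzmem⟩ := AlignedMap.exists_orbit
      (F := fun k => (Ws (-N + k)).coordMap (Ws (-N + k + 1)) (fs (-N + k)))
      (fun k => (halign _).alignedMap) (2 * N)
    refine ⟨fun i => (Ws i).χ (z (min (i + N).toNat (2 * N))), fun i _ =>
      mem_image_of_mem _ (hzmem _ (min_le_right _ _)), fun i hi hi' => ?_⟩
    obtain ⟨k, rfl⟩ : ∃ k : ℕ, i = -N + k := ⟨(i + N).toNat, by omega⟩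
    have h1 : min (-(N : ℤ) + k + N).toNat (2 * N) = k := by omega
    have h2 : min (-(N : ℤ) + k + 1 + N).toNat (2 * N) = k + 1 := by omega
    simp only [h1, h2, hz k]
    exact ((halign _).map_chart (hzmem k (by omega))).symm
  obtain ⟨p, hp⟩ := IsCompact.nonempty_iInter_of_sequence_nonempty_isCompact_isClosed K
    (fun N p hp => ⟨hp.1, fun i hi hi' => hp.2 i (by omega) (by omega)⟩)
    hne (hcompact 0) fun N => (hcompact N).isClosed
  rw [mem_iInter] at hp
  exact ⟨p, fun i => (hp 0).1 i (mem_univ i),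
    fun i => (hp (i.natAbs + 1)).2 i (by omega) (by omega)⟩
end
end

section
/- Topological shadowing lemma for correctly aligned windows (Theorem 5.4, periodic version, for windows with one-dimensional exit): Let M be a topological n-manifold with n = 1 + n₂, let {W_i}_{i∈ℤ} be (1,n₂)-windows and {f_i}_{i∈ℤ} continuous maps on M such that for each i ∈ ℤ, W_i is correctly aligned with W_{i+1} under f_i with degree ±1. Assume there exists k > 0 with W_i = W_{(i mod k)} and f_i = f_{(i mod k)} for all i ∈ ℤ. Then there exists a point p ∈ W₀ with (f_{i} ∘ ⋯ ∘ f₀)(p) ∈ W_{i+1} for all i ≥ 0 which is periodic, in the sense that (f_{k-1} ∘ ⋯ ∘ f₀)(p) = p. -/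
open Set

noncomputable section

variable {M : Type} [TopologicalSpace M] {n₂ : ℕ}

/-- The composition `f_{n-1} ∘ ⋯ ∘ f₀` of the first `n` maps of the sequence `fs`. -/
def orbitComp (fs : ℤ → M → M) : ℕ → M → M
  | 0 => id
  | n + 1 => fs (n : ℤ) ∘ orbitComp fs n

/-- A function that is Lipschitz on the closed unit ball and vanishes on the unit sphere remains
Lipschitz when extended by zero outside the ball. -/
theorem lipschitzWith_indicator_closedBall {E F : Type*} [NormedAddCommGroup E] [NormedSpace ℝ E]
    [NormedAddCommGroup F] {g : E → F} {C : NNReal}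
    (hg : LipschitzOnWith C g (Metric.closedBall 0 1)) (h0 : ∀ x, ‖x‖ = 1 → g x = 0) :
    LipschitzWith C ((Metric.closedBall (0 : E) 1).indicator g) := by
  have key : ∀ x y : E, ‖x‖ ≤ 1 → 1 < ‖y‖ → ‖g x‖ ≤ C * ‖x - y‖ := by
    intro x y hx hy
    have hc : ContinuousOn (fun s : ℝ => ‖AffineMap.lineMap (k := ℝ) x y s‖) (Icc 0 1) := by
      refine Continuous.continuousOn ?_
      exact continuous_norm.comp AffineMap.lineMap_continuous
    have hmem : (1 : ℝ) ∈ Icc (‖AffineMap.lineMap (k := ℝ) x y (0 : ℝ)‖)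
        (‖AffineMap.lineMap (k := ℝ) x y (1 : ℝ)‖) := by
      simp [hx, hy.le]
    obtain ⟨s, hs, hs1⟩ := intermediate_value_Icc zero_le_one hc hmem
    set z : E := AffineMap.lineMap (k := ℝ) x y s with hz
    have hz1 : ‖z‖ = 1 := hs1
    have h1 := hg.dist_le_mul x (by simpa using hx) z (by simp [hz1])
    rw [h0 z hz1, dist_zero_right] at h1
    refine h1.trans (mul_le_mul_of_nonneg_left ?_ C.2)
    rw [hz, dist_left_lineMap, dist_eq_norm, Real.norm_of_nonneg hs.1]
    exact mul_le_of_le_one_left (norm_nonneg _) hs.2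
  refine LipschitzWith.of_dist_le_mul fun x y => ?_
  simp only [dist_eq_norm]
  by_cases hx : ‖x‖ ≤ 1 <;> by_cases hy : ‖y‖ ≤ 1
  · have := hg.dist_le_mul x (by simpa using hx) y (by simpa using hy)
    simpa [indicator, hx, hy, dist_eq_norm] using this
  · simpa [indicator, hx, hy] using key x y hx (not_le.1 hy)
  · rw [norm_sub_rev x y]
    simpa [indicator, hx, hy] using key y x hy (not_le.1 hx)
  · simp [indicator, hx, hy]
    positivity

/-- The determinant of `1 + t A` is a polynomial in `t` whose coefficients depend continuously
on `A`. -/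
theorem exists_det_one_add_smul_eq_sum (E : Type*) [NormedAddCommGroup E] [NormedSpace ℝ E]
    [FiniteDimensional ℝ E] :
    ∃ (N : ℕ) (c : ℕ → (E →L[ℝ] E) → ℝ), (∀ k, Continuous (c k)) ∧
      ∀ (A : E →L[ℝ] E) (t : ℝ),
        (ContinuousLinearMap.id ℝ E + t • A).det = ∑ k ∈ Finset.range N, c k A * t ^ k := by
  classical
  let b := Module.finBasis ℝ E
  let n := Module.finrank ℝ E
  have hent : ∀ i j, Continuous fun A : E →L[ℝ] E => b.repr (A (b j)) i := by
    intro i j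
    have h1 : Continuous fun A : E →L[ℝ] E => A (b j) := by fun_prop
    exact (LinearMap.continuous_of_finiteDimensional (b.coord i)).comp h1
  let P : (E →L[ℝ] E) → Polynomial ℝ := fun A =>
    ∑ σ : Equiv.Perm (Fin n), ∑ s ∈ (Finset.univ : Finset (Fin n)).powerset,
      Polynomial.monomial (Finset.univ \ s).card
        (((Equiv.Perm.sign σ : ℤ) : ℝ) * ((∏ i ∈ s, (1 : Matrix (Fin n) (Fin n) ℝ) (σ i) i) *
          ∏ i ∈ Finset.univ \ s, b.repr (A (b i)) (σ i)))
  have hdeg : ∀ A, (P A).natDegree < n + 1 := by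
    intro A
    refine Nat.lt_succ_of_le ?_
    refine Polynomial.natDegree_sum_le_of_forall_le _ _ fun σ _ => ?_
    refine Polynomial.natDegree_sum_le_of_forall_le _ _ fun s _ => ?_
    refine (Polynomial.natDegree_monomial_le _).trans ?_
    simpa using Finset.card_le_univ (Finset.univ \ s)
  refine ⟨n + 1, fun k A => (P A).coeff k, fun k => ?_, fun A t => ?_⟩
  · simp only [P, Polynomial.finsetSum_coeff, Polynomial.coeff_monomial]
    refine continuous_finsetSum _ fun σ _ => continuous_finsetSum _ fun s _ => ?_
    split_ifs
    · exact continuous_const.mul (continuous_const.mul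
        (continuous_finsetProd _ fun i _ => hent _ _))
    · exact continuous_const
  · rw [← Polynomial.eval_eq_sum_range' (hdeg A)]
    rw [ContinuousLinearMap.det, ← LinearMap.det_toMatrix b, Matrix.det_apply']
    simp only [P, Polynomial.eval_finsetSum, Polynomial.eval_monomial]
    refine Finset.sum_congr rfl fun σ _ => ?_
    have : ∀ i, LinearMap.toMatrix b b
        (((ContinuousLinearMap.id ℝ E + t • A : E →L[ℝ] E)) : E →ₗ[ℝ] E) (σ i) i
        = (1 : Matrix (Fin n) (Fin n) ℝ) (σ i) i + b.repr (A (b i)) (σ i) * t := by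
      intro i
      simp [LinearMap.toMatrix_apply, Matrix.one_apply, Finsupp.single_apply, mul_comm, eq_comm]
    simp only [this]
    rw [Finset.prod_add, Finset.mul_sum]
    refine Finset.sum_congr rfl fun s _ => ?_
    rw [Finset.prod_mul_distrib, Finset.prod_const]
    ring

/-- For a map that differs from the identity by `t g`, with `g` vanishing on the unit sphere and
`t` small, the integral of the Jacobian over the unit ball is the volume of the ball. -/
theorem integral_det_id_add_smul_fderiv {E : Type*} [NormedAddCommGroup E] [NormedSpace ℝ E]
    [FiniteDimensional ℝ E] [MeasurableSpace E] [BorelSpace E] (μ : MeasureTheory.Measure E)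
    [μ.IsAddHaarMeasure] {g : E → E} (hg : ContDiff ℝ 1 g) (h0 : ∀ x, ‖x‖ = 1 → g x = 0)
    {C : ℝ} (hC0 : 0 ≤ C) (hC : ∀ x ∈ Metric.closedBall (0 : E) 1, ‖fderiv ℝ g x‖ ≤ C)
    {t : ℝ} (ht0 : 0 ≤ t) (htC : t * C < 1) :
    ∫ x in Metric.closedBall (0 : E) 1, (ContinuousLinearMap.id ℝ E + t • fderiv ℝ g x).det ∂μ
      = μ.real (Metric.closedBall 0 1) := by
  set B := Metric.closedBall (0 : E) 1 with hB
  have hLip : LipschitzOnWith ⟨C, hC0⟩ g B :=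
    (convex_closedBall (0 : E) 1).lipschitzOnWith_of_nnnorm_fderiv_le
      (fun x _ => (hg.differentiable one_ne_zero) x) (fun x hx => hC x hx)
  have hLip' := lipschitzWith_indicator_closedBall hLip h0
  let F : E → E := fun x => x + t • B.indicator g x
  have hF : ApproximatesLinearOn F ((ContinuousLinearEquiv.refl ℝ E : E ≃L[ℝ] E) : E →L[ℝ] E) univ
      (⟨t, ht0⟩ * ⟨C, hC0⟩) := by
    rw [ApproximatesLinearOn.approximatesLinearOn_iff_lipschitzOnWith, lipschitzOnWith_univ]
    refine LipschitzWith.of_dist_le_mul fun x y => ?_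
    have := hLip'.dist_le_mul x y
    simp only [dist_eq_norm] at this ⊢
    have e : (F - ⇑((ContinuousLinearEquiv.refl ℝ E : E ≃L[ℝ] E) : E →L[ℝ] E)) x -
        (F - ⇑((ContinuousLinearEquiv.refl ℝ E : E ≃L[ℝ] E) : E →L[ℝ] E)) y
        = t • (B.indicator g x - B.indicator g y) := by
      simp [F, smul_sub]
    rw [e, norm_smul, Real.norm_of_nonneg ht0]
    calc t * _ ≤ t * (C * ‖x - y‖) := mul_le_mul_of_nonneg_left this ht0
      _ = t * C * ‖x - y‖ := by ring
  have hc : Subsingleton E ∨ (⟨t, ht0⟩ * ⟨C, hC0⟩ : NNReal) <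
      ‖(((ContinuousLinearEquiv.refl ℝ E : E ≃L[ℝ] E).symm : E ≃L[ℝ] E) : E →L[ℝ] E)‖₊⁻¹ := by
    rcases subsingleton_or_nontrivial E with h | h
    · exact Or.inl h
    · right
      have : ‖(((ContinuousLinearEquiv.refl ℝ E : E ≃L[ℝ] E).symm : E ≃L[ℝ] E) : E →L[ℝ] E)‖₊
          = 1 := by
        apply NNReal.eq
        exact ContinuousLinearMap.norm_id
      rw [this, inv_one]
      exact htC
  have hinj : Function.Injective F := injOn_univ.1 (hF.injOn hc)
  have hsurj : Function.Surjective F := hF.surjective hc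
  have hout : ∀ x, x ∉ B → F x = x := fun x hx => by simp [F, hx]
  have himg : F '' B = B := by
    have h1 : F '' Bᶜ = Bᶜ := by
      ext y
      constructor
      · rintro ⟨x, hx, rfl⟩
        rwa [hout x hx]
      · intro hy
        exact ⟨y, hy, hout y hy⟩
    have h2 := image_compl_eq (f := F) (s := B) ⟨hinj, hsurj⟩
    rw [h1] at h2
    exact (compl_inj_iff.1 h2).symm
  have hdet : ∀ x ∈ B, 0 < (ContinuousLinearMap.id ℝ E + t • fderiv ℝ g x).det := by
    intro x hx
    have hne : ∀ s ∈ Icc (0 : ℝ) t, (ContinuousLinearMap.id ℝ E + s • fderiv ℝ g x).det ≠ 0 := by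
      intro s hs hz
      obtain ⟨v, hv, hv0⟩ := (Submodule.ne_bot_iff _).1
        (LinearMap.bot_lt_ker_of_det_eq_zero hz).ne'
      have hv' : v + s • fderiv ℝ g x v = 0 := by simpa using hv
      have h3 : ‖v‖ ≤ t * C * ‖v‖ := by
        calc ‖v‖ = ‖s • fderiv ℝ g x v‖ := by
              rw [← norm_neg (s • _)]
              exact congrArg norm (eq_neg_of_add_eq_zero_left hv')
          _ = s * ‖fderiv ℝ g x v‖ := by rw [norm_smul, Real.norm_of_nonneg hs.1]
          _ ≤ t * (C * ‖v‖) := mul_le_mul hs.2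
              ((fderiv ℝ g x).le_of_opNorm_le (hC x hx) v) (norm_nonneg _) ht0
          _ = _ := by ring
      have : 0 < ‖v‖ := norm_pos_iff.2 hv0
      nlinarith
    have hcont : Continuous fun s : ℝ => (ContinuousLinearMap.id ℝ E + s • fderiv ℝ g x).det :=
      ContinuousLinearMap.continuous_det.comp (by fun_prop)
    by_contra! hle
    obtain ⟨s, hs, hs0⟩ := intermediate_value_Icc' ht0 hcont.continuousOn
      (show (0 : ℝ) ∈ Icc _ _ from ⟨hle, by simp [ContinuousLinearMap.det]⟩)
    exact hne s hs hs0
  have hder : ∀ x ∈ B, HasFDerivWithinAt F (ContinuousLinearMap.id ℝ E + t • fderiv ℝ g x) B x := by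
    intro x hx
    have h1 : HasFDerivAt (fun x => x + t • g x)
        (ContinuousLinearMap.id ℝ E + t • fderiv ℝ g x) x :=
      (hasFDerivAt_id x).add (((hg.differentiable one_ne_zero) x).hasFDerivAt.const_smul t)
    exact h1.hasFDerivWithinAt.congr (fun y hy => by simp [F, hy]) (by simp [F, hx])
  have h := MeasureTheory.integral_image_eq_integral_abs_det_fderiv_smul μ
    Metric.isClosed_closedBall.measurableSet hder hinj.injOn (fun _ => (1 : ℝ))
  rw [himg] at h
  rw [MeasureTheory.setIntegral_const] at h
  simp only [smul_eq_mul, mul_one] at h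
  rw [h]
  refine MeasureTheory.setIntegral_congr_fun Metric.isClosed_closedBall.measurableSet fun x hx => ?_
  exact (abs_of_pos (hdet x hx)).symm

/-- There is no `C¹` retraction of the closed unit ball onto the unit sphere. -/
theorem no_contDiff_retraction {E : Type*} [NormedAddCommGroup E] [InnerProductSpace ℝ E]
    [FiniteDimensional ℝ E] {f : E → E} (hf : ContDiff ℝ 1 f) (hnorm : ∀ x, ‖f x‖ = 1)
    (hfix : ∀ x, ‖x‖ = 1 → f x = x) : False := by
  borelize E
  let μ : MeasureTheory.Measure E := MeasureTheory.Measure.addHaar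
  let B := Metric.closedBall (0 : E) 1
  have hBc : IsCompact B := isCompact_closedBall 0 1
  let g : E → E := fun x => f x - x
  have hg : ContDiff ℝ 1 g := hf.sub contDiff_id
  have hg' : Continuous (fderiv ℝ g) := hg.continuous_fderiv one_ne_zero
  obtain ⟨C, hC⟩ := hBc.exists_bound_of_continuousOn hg'.continuousOn
  have hC0 : 0 ≤ C := (norm_nonneg _).trans (hC 0 (by simp [B]))
  obtain ⟨N, c, hc, hdet⟩ := exists_det_one_add_smul_eq_sum E
  let p : Polynomial ℝ :=
    ∑ k ∈ Finset.range N, Polynomial.monomial k (∫ x in B, c k (fderiv ℝ g x) ∂μ)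
  have hp : ∀ t, p.eval t =
      ∫ x in B, (ContinuousLinearMap.id ℝ E + t • fderiv ℝ g x).det ∂μ := by
    intro t
    simp only [hdet, p, Polynomial.eval_finsetSum, Polynomial.eval_monomial]
    rw [MeasureTheory.integral_finsetSum]
    · simp only [MeasureTheory.integral_mul_const]
    · intro k _
      exact (((hc k).comp hg').mul continuous_const).continuousOn.integrableOn_compact hBc
  have hpC : p = Polynomial.C (μ.real B) := by
    refine Polynomial.eq_of_infinite_eval_eq _ _ ?_
    refine (Icc_infinite (show (0 : ℝ) < 1 / (C + 1) by positivity)).mono fun t ht => ?_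
    simp only [mem_ofPred_eq, Polynomial.eval_C]
    rw [hp t]
    refine integral_det_id_add_smul_fderiv μ hg (fun x hx => by simp [g, hfix x hx]) hC0 hC ht.1 ?_
    have h2 := ht.2
    rw [le_div_iff₀ (by positivity)] at h2
    rcases ht.1.eq_or_lt with h | h
    · simp [← h]
    · linarith
  have h1 : p.eval 1 = 0 := by
    rw [hp 1]
    refine MeasureTheory.integral_eq_zero_of_ae (Filter.Eventually.of_forall fun x => ?_)
    have hfx : HasFDerivAt f (fderiv ℝ f x) x := ((hf.differentiable one_ne_zero) x).hasFDerivAt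
    have e : ContinuousLinearMap.id ℝ E + (1 : ℝ) • fderiv ℝ g x = fderiv ℝ f x := by
      have : HasFDerivAt g (fderiv ℝ f x - ContinuousLinearMap.id ℝ E) x :=
        hfx.sub (hasFDerivAt_id x)
      rw [this.fderiv]
      simp
    have horth : ∀ v, inner ℝ (f x) (fderiv ℝ f x v) = 0 := by
      intro v
      have h2 : HasFDerivAt (fun y => inner ℝ (f y) (f y)) _ x := hfx.inner ℝ hfx
      have h3 : (fun y => inner ℝ (f y) (f y)) = fun _ => (1 : ℝ) := by
        funext y
        rw [real_inner_self_eq_norm_sq, hnorm y, one_pow]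
      rw [h3] at h2
      have h4 := congrArg (fun L => L v) (h2.unique (hasFDerivAt_const (1 : ℝ) x))
      simp [fderivInnerCLM_apply, real_inner_comm] at h4
      rw [real_inner_comm] at h4 ⊢
      linarith
    simp only [e, Pi.zero_apply]
    by_contra hne
    have hs : Function.Surjective (fderiv ℝ f x) :=
      (LinearMap.equivOfDetNeZero (fderiv ℝ f x : E →ₗ[ℝ] E) hne).surjective
    obtain ⟨v, hv⟩ := hs (f x)
    have h5 := horth v
    rw [hv, real_inner_self_eq_norm_sq, hnorm x] at h5
    norm_num at h5
  rw [hpC, Polynomial.eval_C] at h1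
  have hpos : 0 < μ.real B :=
    ENNReal.toReal_pos (Metric.measure_closedBall_pos μ 0 one_pos).ne' hBc.measure_lt_top.ne
  exact hpos.ne' h1

/-- A continuous self-map of a Euclidean space that is the identity outside a bounded set has a
zero. -/
theorem exists_eq_zero_of_eq_id_outside_ball {E : Type*} [NormedAddCommGroup E]
    [InnerProductSpace ℝ E] [FiniteDimensional ℝ E] {G : E → E} (hG : Continuous G) {R : ℝ}
    (hR : 0 < R) (hfix : ∀ x, R ≤ ‖x‖ → G x = x) : ∃ x, G x = 0 := by
  by_contra! hne
  obtain ⟨δ, hδ, hδG⟩ : ∃ δ > 0, ∀ x, δ ≤ ‖G x‖ := by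
    obtain ⟨x₀, -, hx₀⟩ := (isCompact_closedBall (0 : E) R).exists_isMinOn
      ⟨0, by simp [hR.le]⟩ hG.norm.continuousOn
    refine ⟨min ‖G x₀‖ R, lt_min (norm_pos_iff.2 (hne x₀)) hR, fun x => ?_⟩
    rcases le_total ‖x‖ R with h | h
    · exact (min_le_left _ _).trans (hx₀ (by simpa using h))
    · rw [hfix x h]
      exact (min_le_right _ _).trans h
  obtain ⟨g, hg, hgG, hsupp⟩ := (hG.sub continuous_id).exists_contDiff_approx 1
    (ε := fun _ => δ) continuous_const (fun _ => hδ)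
  have hg0 : ∀ x, R ≤ ‖x‖ → g x = 0 := by
    intro x hx
    by_contra h
    exact hsupp h (by simp [hfix x hx])
  have hS : ∀ x, x + g x ≠ 0 := by
    intro x h0
    have h1 := hgG x
    rw [dist_eq_norm] at h1
    have h2 : g x - (G x - x) = -G x := by
      rw [eq_neg_of_add_eq_zero_right h0]; abel
    simp only [Pi.sub_apply, id] at h1
    rw [h2, norm_neg] at h1
    exact absurd h1 (not_lt.2 (hδG x))
  have hSd : ContDiff ℝ 1 fun x : E => R • x + g (R • x) :=
    (contDiff_id.const_smul R).add (hg.comp (contDiff_id.const_smul R))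
  refine no_contDiff_retraction
    (f := fun x => ‖R • x + g (R • x)‖⁻¹ • (R • x + g (R • x))) ?_ ?_ ?_
  · exact ((hSd.norm ℝ fun x => hS _).inv fun x => norm_ne_zero_iff.2 (hS _)).smul hSd
  · intro x
    rw [norm_smul, norm_inv, norm_norm, inv_mul_cancel₀ (norm_ne_zero_iff.2 (hS _))]
  · intro x hx
    have h1 : ‖R • x‖ = R := by rw [norm_smul, hx, mul_one, Real.norm_of_nonneg hR.le]
    simp only [hg0 _ h1.ge, add_zero, h1]
    rw [smul_smul, inv_mul_cancel₀ hR.ne', one_smul]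

/-- Topological transversality: a homotopy without zeros on `K \ U`, ending at an affine
isomorphism with a zero in `U`, starts at a map with a zero in `U`. -/
theorem exists_zero_of_homotopy_affine {V : Type*} [NormedAddCommGroup V] [NormedSpace ℝ V]
    [FiniteDimensional ℝ V] {U K : Set V} (hU : IsOpen U) (hK : IsCompact K) (hUK : U ⊆ K)
    {H : ℝ → V → V} (hH : Continuous fun q : ℝ × V => H q.1 q.2) (L : V →ₗ[ℝ] V)
    (hL : Function.Injective L) {c : V} (hc : c ∈ U) (h1 : ∀ x, H 1 x = L (x - c))
    (hbd : ∀ s ∈ Icc (0 : ℝ) 1, ∀ x ∈ K, H s x = 0 → x ∈ U) :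
    ∃ x ∈ U, H 0 x = 0 := by
  let A : Set V := Prod.snd '' ((Icc (0 : ℝ) 1 ×ˢ K) ∩ {q : ℝ × V | H q.1 q.2 = 0})
  have hA : IsClosed A :=
    (((isCompact_Icc.prod hK).inter_right (isClosed_eq hH continuous_const)).image
      continuous_snd).isClosed
  have hAU : Disjoint A Uᶜ := by
    rw [disjoint_compl_right_iff_subset]
    rintro _ ⟨⟨s, x⟩, ⟨⟨hs, hx⟩, h⟩, rfl⟩
    exact hbd s hs x hx h
  obtain ⟨l, hl0, hl1, hl⟩ := exists_continuous_zero_one_of_isClosed hA hU.isClosed_compl hAU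
  let T := LinearEquiv.ofInjectiveEndo L hL
  let e : V ≃L[ℝ] EuclideanSpace ℝ (Fin (Module.finrank ℝ V)) := toEuclidean
  let G : EuclideanSpace ℝ (Fin (Module.finrank ℝ V)) →
      EuclideanSpace ℝ (Fin (Module.finrank ℝ V)) :=
    fun y => e (T.symm (H (l (e.symm y + c)) (e.symm y + c)))
  have hG : Continuous G := by
    refine e.continuous.comp ((LinearMap.continuous_of_finiteDimensional
      (T.symm : V →ₗ[ℝ] V)).comp (hH.comp (Continuous.prodMk ?_ ?_))) <;> fun_prop
  obtain ⟨R, hR⟩ := ((hK.image (continuous_id.sub continuous_const)).image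
    e.continuous).isBounded.exists_pos_norm_lt (s := e '' ((fun x => x - c) '' K))
  obtain ⟨y, hy⟩ := exists_eq_zero_of_eq_id_outside_ball hG hR.1 (fun y hy => by
    have hout : e.symm y + c ∉ U := fun h => by
      have := hR.2 y ⟨e.symm y, ⟨_, hUK h, by simp⟩, by simp⟩
      exact absurd this (not_lt.2 hy)
    simp only [G]
    rw [hl1 hout]
    simp only [Pi.one_apply, h1, add_sub_cancel_right]
    rw [show L (e.symm y) = T (e.symm y) from rfl, LinearEquiv.symm_apply_apply]
    simp)
  have hz : H (l (e.symm y + c)) (e.symm y + c) = 0 := by simpa [G] using hy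
  have hin : e.symm y + c ∈ U := by
    by_contra hout
    rw [hl1 hout] at hz
    simp only [Pi.one_apply, h1, add_sub_cancel_right] at hz
    rw [(map_eq_zero_iff L hL).1 hz, zero_add] at hout
    exact hout hc
  have hmem : e.symm y + c ∈ A := ⟨(_, _), ⟨⟨hl _, hUK hin⟩, hz⟩, rfl⟩
  rw [hl0 hmem] at hz
  exact ⟨_, hin, hz⟩

/-- The coordinatewise retraction of `ℝ × ℝ^{n₂}` onto the unit cube. -/
def cubeClamp (n₂ : ℕ) (p : ℝ × (Fin n₂ → ℝ)) : ℝ × (Fin n₂ → ℝ) :=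
  (max 0 (min 1 p.1), fun j => max 0 (min 1 (p.2 j)))

theorem continuous_cubeClamp (n₂ : ℕ) : Continuous (cubeClamp n₂) := by
  unfold cubeClamp
  fun_prop

theorem cubeClamp_mem (p : ℝ × (Fin n₂ → ℝ)) : cubeClamp n₂ p ∈ Cube n₂ :=
  ⟨⟨le_max_left _ _, max_le zero_le_one (min_le_left _ _)⟩,
    fun _ => le_max_left _ _, fun _ => max_le zero_le_one (min_le_left _ _)⟩

theorem cubeClamp_of_mem {p : ℝ × (Fin n₂ → ℝ)} (hp : p ∈ Cube n₂) : cubeClamp n₂ p = p := by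
  obtain ⟨⟨h0, h1⟩, h2, h3⟩ := hp
  refine Prod.ext ?_ (funext fun j => ?_)
  · simp [cubeClamp, h0, h1]
  · have h2' : 0 ≤ p.2 j := h2 j
    have h3' : p.2 j ≤ 1 := h3 j
    simp [cubeClamp, h2', h3']

/-- The homotopy from `F` to the linear expansion of slope `2 ε` in the exit direction: for
`s ≤ 1/2` the entry coordinates are contracted to `y₀`, for `s ≥ 1/2` one interpolates linearly. -/
def expandHomotopy (F : ℝ × (Fin n₂ → ℝ) → ℝ × (Fin n₂ → ℝ)) (y₀ : Fin n₂ → ℝ) (ε : ℝ) (s : ℝ)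
    (p : ℝ × (Fin n₂ → ℝ)) : ℝ × (Fin n₂ → ℝ) :=
  (1 - max 0 (2 * s - 1)) • F (cubeClamp n₂ (p.1, p.2 + min 1 (2 * s) • (y₀ - p.2))) +
    max 0 (2 * s - 1) • (1 / 2 + 2 * ε * (p.1 - 1 / 2), fun _ => 1 / 2)

theorem continuous_expandHomotopy {F : ℝ × (Fin n₂ → ℝ) → ℝ × (Fin n₂ → ℝ)}
    (hF : ContinuousOn F (Cube n₂)) (y₀ : Fin n₂ → ℝ) (ε : ℝ) :
    Continuous fun q : ℝ × (ℝ × (Fin n₂ → ℝ)) => expandHomotopy F y₀ ε q.1 q.2 := by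
  have h : Continuous fun p => F (cubeClamp n₂ p) :=
    hF.comp_continuous (continuous_cubeClamp n₂) cubeClamp_mem
  have h' : Continuous fun q : ℝ × (ℝ × (Fin n₂ → ℝ)) =>
      F (cubeClamp n₂ (q.2.1, q.2.2 + min 1 (2 * q.1) • (y₀ - q.2.2))) :=
    h.comp (g := fun p => F (cubeClamp n₂ p))
      (f := fun q : ℝ × (ℝ × (Fin n₂ → ℝ)) => (q.2.1, q.2.2 + min 1 (2 * q.1) • (y₀ - q.2.2)))
      (by fun_prop)
  unfold expandHomotopy
  refine Continuous.fun_add (Continuous.fun_smul ?_ h') ?_ <;> fun_prop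

/-- A point of the cube that `expandHomotopy` keeps in the cube lies off the exit faces, and its
image lies off the entry faces. -/
theorem expandHomotopy_mem_cube {F : ℝ × (Fin n₂ → ℝ) → ℝ × (Fin n₂ → ℝ)} {y₀ : Fin n₂ → ℝ} {ε : ℝ}
    (hexit : ∀ x ∈ ({0, 1} : Set ℝ) ×ˢ Icc (0 : Fin n₂ → ℝ) 1, F x ∉ Cube n₂)
    (hentry : ∀ x ∈ Cube n₂, F x ∉ Icc (0 : ℝ) 1 ×ˢ
      {y : Fin n₂ → ℝ | y ∈ Icc (0 : Fin n₂ → ℝ) 1 ∧ ∃ i, y i = 0 ∨ y i = 1})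
    (hy₀ : y₀ ∈ Icc (0 : Fin n₂ → ℝ) 1)
    (hmid : ∀ t ∈ Icc (0 : ℝ) 1, ∀ j, (F (t, y₀)).2 j ∈ Ioo (0 : ℝ) 1)
    (hε : (ε = 1 ∧ (F (0, y₀)).1 < 0 ∧ 1 < (F (1, y₀)).1) ∨
      (ε = -1 ∧ (F (1, y₀)).1 < 0 ∧ 1 < (F (0, y₀)).1))
    {s : ℝ} (hs : s ∈ Icc (0 : ℝ) 1) {p : ℝ × (Fin n₂ → ℝ)} (hp : p ∈ Cube n₂)
    (hmem : expandHomotopy F y₀ ε s p ∈ Cube n₂) :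
    p.1 ∈ Ioo (0 : ℝ) 1 ∧ ∀ j, (expandHomotopy F y₀ ε s p).2 j ∈ Ioo (0 : ℝ) 1 := by
  obtain ⟨a, b⟩ := p
  obtain ⟨ha, hb⟩ := hp
  simp only at ha hb
  rcases le_total s (1 / 2) with h | h
  · have hv : max 0 (2 * s - 1) = 0 := max_eq_left (by linarith)
    have hu : min 1 (2 * s) = 2 * s := min_eq_right (by linarith)
    have hb' : b + (2 * s) • (y₀ - b) ∈ Icc (0 : Fin n₂ → ℝ) 1 :=
      (convex_Icc 0 1).add_smul_sub_mem hb hy₀ ⟨by linarith [hs.1], by linarith⟩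
    have e : expandHomotopy F y₀ ε s (a, b) = F (a, b + (2 * s) • (y₀ - b)) := by
      have := cubeClamp_of_mem (p := (a, b + (2 * s) • (y₀ - b))) ⟨ha, hb'⟩
      simp [expandHomotopy, hv, hu, this]
    rw [e] at hmem ⊢
    constructor
    · refine ⟨ha.1.lt_of_ne fun h0 => ?_, ha.2.lt_of_ne fun h1 => ?_⟩
      · exact hexit _ ⟨Or.inl h0.symm, hb'⟩ hmem
      · exact hexit (a, _) ⟨Or.inr h1, hb'⟩ hmem
    · intro j
      refine ⟨(hmem.2.1 j).lt_of_ne fun h0 => ?_, (hmem.2.2 j).lt_of_ne fun h1 => ?_⟩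
      · exact hentry _ ⟨ha, hb'⟩ ⟨hmem.1, hmem.2, j, Or.inl h0.symm⟩
      · exact hentry _ ⟨ha, hb'⟩ ⟨hmem.1, hmem.2, j, Or.inr h1⟩
  · have hv : max 0 (2 * s - 1) = 2 * s - 1 := max_eq_right (by linarith)
    have hu : min 1 (2 * s) = 1 := min_eq_left (by linarith)
    have hs1 := hs.2
    obtain ⟨w, hw⟩ : ∃ w, w = 2 * s - 1 := ⟨_, rfl⟩
    rw [← hw] at hv
    have hw0 : 0 ≤ w := by linarith
    have hw1 : 0 ≤ 1 - w := by linarith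
    have e : expandHomotopy F y₀ ε s (a, b) =
        (1 - w) • F (a, y₀) + w • (1 / 2 + 2 * ε * (a - 1 / 2), fun _ => 1 / 2) := by
      have := cubeClamp_of_mem (p := (a, y₀)) ⟨ha, hy₀⟩
      simp [expandHomotopy, ← hw, hv, hu, this]
    rw [e] at hmem ⊢
    have neg : ∀ {A B : ℝ}, A < 0 → B < 0 → (1 - w) * A + w * B < 0 := fun {A B} hA hB => by
      rcases hw0.eq_or_lt with h | h
      · simpa [← h] using hA
      · nlinarith
    have big : ∀ {A B : ℝ}, 1 < A → 1 < B → 1 < (1 - w) * A + w * B := fun {A B} hA hB => by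
      have := neg (sub_neg.2 hA) (sub_neg.2 hB)
      linarith
    constructor
    · have hm0 : 0 ≤ (1 - w) * (F (a, y₀)).1 + w * (1 / 2 + 2 * ε * (a - 1 / 2)) := hmem.1.1
      have hm1 : (1 - w) * (F (a, y₀)).1 + w * (1 / 2 + 2 * ε * (a - 1 / 2)) ≤ 1 := hmem.1.2
      refine ⟨ha.1.lt_of_ne ?_, ha.2.lt_of_ne ?_⟩ <;> rintro rfl <;>
        rcases hε with ⟨rfl, h0, h1⟩ | ⟨rfl, h0, h1⟩
      · exact absurd hm0 (not_le.2 (neg h0 (by norm_num)))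
      · exact absurd hm1 (not_le.2 (big h1 (by norm_num)))
      · exact absurd hm1 (not_le.2 (big h1 (by norm_num)))
      · exact absurd hm0 (not_le.2 (neg h0 (by norm_num)))
    · intro j
      exact (convex_Ioo (0 : ℝ) 1) (hmid a ha j) (y := 1 / 2) (by norm_num) hw1 hw0 (by ring)

/-- A cyclic chain of maps of the unit cube, each of which crosses the next cube in the exit
direction, has a closed orbit. -/
theorem exists_cyclic_orbit {ι : Type*} [Fintype ι] (τ : ι ≃ ι)
    (F : ι → ℝ × (Fin n₂ → ℝ) → ℝ × (Fin n₂ → ℝ)) (hF : ∀ i, ContinuousOn (F i) (Cube n₂))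
    (hexit : ∀ i, ∀ x ∈ ({0, 1} : Set ℝ) ×ˢ Icc (0 : Fin n₂ → ℝ) 1, F i x ∉ Cube n₂)
    (hentry : ∀ i, ∀ x ∈ Cube n₂, F i x ∉ Icc (0 : ℝ) 1 ×ˢ
      {y : Fin n₂ → ℝ | y ∈ Icc (0 : Fin n₂ → ℝ) 1 ∧ ∃ i, y i = 0 ∨ y i = 1})
    (hcross : ∀ i, ∃ y₀ ∈ Icc (0 : Fin n₂ → ℝ) 1,
      (∀ t ∈ Icc (0 : ℝ) 1, ∀ j, (F i (t, y₀)).2 j ∈ Ioo (0 : ℝ) 1) ∧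
      (((F i (0, y₀)).1 < 0 ∧ 1 < (F i (1, y₀)).1) ∨
        ((F i (1, y₀)).1 < 0 ∧ 1 < (F i (0, y₀)).1))) :
    ∃ x : ι → ℝ × (Fin n₂ → ℝ), ∀ i, x i ∈ Cube n₂ ∧ F i (x i) = x (τ i) := by
  choose y₀ hy₀ hmid hside using hcross
  have hε : ∀ i, ∃ ε : ℝ, (ε = 1 ∧ (F i (0, y₀ i)).1 < 0 ∧ 1 < (F i (1, y₀ i)).1) ∨
      (ε = -1 ∧ (F i (1, y₀ i)).1 < 0 ∧ 1 < (F i (0, y₀ i)).1) := fun i =>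
    (hside i).elim (fun h => ⟨1, Or.inl ⟨rfl, h⟩⟩) fun h => ⟨-1, Or.inr ⟨rfl, h⟩⟩
  choose ε hε using hε
  have hε1 : ∀ i, |ε i| = 1 := fun i => by
    rcases hε i with ⟨h, -⟩ | ⟨h, -⟩ <;> simp [h]
  let K : Set (ι → ℝ × (Fin n₂ → ℝ)) := univ.pi fun _ => Cube n₂
  let U : Set (ι → ℝ × (Fin n₂ → ℝ)) :=
    univ.pi fun _ => Ioo (0 : ℝ) 1 ×ˢ univ.pi fun _ => Ioo (0 : ℝ) 1
  let H : ℝ → (ι → ℝ × (Fin n₂ → ℝ)) → ι → ℝ × (Fin n₂ → ℝ) :=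
    fun s x i => x (τ i) - expandHomotopy (F i) (y₀ i) (ε i) s (x i)
  let L : (ι → ℝ × (Fin n₂ → ℝ)) →ₗ[ℝ] ι → ℝ × (Fin n₂ → ℝ) :=
    { toFun := fun z i => z (τ i) - (2 * ε i * (z i).1, 0)
      map_add' := fun z w => by
        funext i
        refine Prod.ext ?_ ?_ <;> simp
        ring
      map_smul' := fun r z => by
        funext i
        refine Prod.ext ?_ ?_ <;> simp
        ring }
  have hU : IsOpen U := isOpen_set_pi finite_univ fun _ _ =>
    isOpen_Ioo.prod (isOpen_set_pi finite_univ fun _ _ => isOpen_Ioo)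
  have hK : IsCompact K := isCompact_univ_pi fun _ => isCompact_Icc.prod isCompact_Icc
  have hUK : U ⊆ K := fun x hx i _ => ⟨Ioo_subset_Icc_self (hx i trivial).1,
    fun j => ((hx i trivial).2 j trivial).1.le, fun j => ((hx i trivial).2 j trivial).2.le⟩
  have hH : Continuous fun q : ℝ × (ι → ℝ × (Fin n₂ → ℝ)) => H q.1 q.2 := by
    refine continuous_pi fun i => ?_
    have h1 := (continuous_expandHomotopy (hF i) (y₀ i) (ε i)).comp
      (f := fun q : ℝ × (ι → ℝ × (Fin n₂ → ℝ)) => (q.1, q.2 i)) (by fun_prop)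
    exact Continuous.sub (by fun_prop) h1
  have hL : Function.Injective L := by
    refine (injective_iff_map_eq_zero L).2 fun z hz => ?_
    have hz' : ∀ i, z (τ i) = (2 * ε i * (z i).1, 0) := fun i => sub_eq_zero.1 (congrFun hz i)
    have hsum : ∑ i, |(z i).1| = 2 * ∑ i, |(z i).1| := by
      calc ∑ i, |(z i).1| = ∑ i, |(z (τ i)).1| := (Equiv.sum_comp τ fun i => |(z i).1|).symm
        _ = ∑ i, 2 * |(z i).1| := Finset.sum_congr rfl fun i _ => by
            rw [hz' i]; simp [abs_mul, hε1 i]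
        _ = _ := (Finset.mul_sum _ _ _).symm
    have h0 : ∑ i, |(z i).1| = 0 := by linarith
    rw [Finset.sum_eq_zero_iff_of_nonneg fun i _ => abs_nonneg _] at h0
    funext i
    refine Prod.ext (abs_eq_zero.1 (h0 i (Finset.mem_univ i))) ?_
    have := hz' (τ.symm i)
    rw [τ.apply_symm_apply] at this
    rw [this]; rfl
  obtain ⟨x, hxU, hx⟩ := exists_zero_of_homotopy_affine hU hK hUK hH L hL
    (c := fun _ => (1 / 2, fun _ => 1 / 2))
    (fun i _ => ⟨by norm_num, fun j _ => by norm_num⟩)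
    (fun x => by
      funext i
      refine Prod.ext ?_ (funext fun j => ?_)
      · simp [H, L, expandHomotopy]
        norm_num
        ring
      · simp [H, L, expandHomotopy]
        norm_num)
    (fun s hs x hxK hx => by
      have hx' : ∀ i, x (τ i) = expandHomotopy (F i) (y₀ i) (ε i) s (x i) := fun i =>
        sub_eq_zero.1 (congrFun hx i)
      have hstep := fun i => expandHomotopy_mem_cube (hexit i) (hentry i) (hy₀ i) (hmid i) (hε i)
        hs (hxK i trivial) (hx' i ▸ hxK (τ i) trivial)
      intro i _
      refine ⟨(hstep i).1, fun j _ => ?_⟩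
      have := (hstep (τ.symm i)).2 j
      rwa [← hx' (τ.symm i), τ.apply_symm_apply] at this)
  refine ⟨x, fun i => ⟨hUK hxU i trivial, ?_⟩⟩
  have h1 := sub_eq_zero.1 (congrFun hx i)
  have h2 := cubeClamp_of_mem (hUK hxU i trivial)
  rw [h1]
  simp [expandHomotopy, h2]

/-- **Topological shadowing lemma for correctly aligned windows** (Theorem 5.4, periodic
version, for windows with one-dimensional exit): if moreover the windows and maps are
`k`-periodic, then the shadowing point `p ∈ W₀` can be chosen periodic, i.e.
`(f_{k-1} ∘ ⋯ ∘ f₀)(p) = p`. -/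
theorem shadowing_periodic {n₂ : ℕ} (hn₂ : 1 ≤ n₂)
    {M : Type} [TopologicalSpace M] [T2Space M]
    [ChartedSpace (ℝ × (Fin n₂ → ℝ)) M]
    (Ws : ℤ → Window M n₂) (fs : ℤ → M → M)
    (halign : ∀ i : ℤ, CorrectlyAligned (Ws i) (Ws (i + 1)) (fs i))
    (k : ℕ) (hk : 0 < k)
    (hWper : ∀ i : ℤ, Ws i = Ws (i % (k : ℤ)))
    (hfper : ∀ i : ℤ, fs i = fs (i % (k : ℤ))) :
    ∃ p ∈ (Ws 0).carrier,
      (∀ i : ℕ, orbitComp fs (i + 1) p ∈ (Ws ((i : ℤ) + 1)).carrier) ∧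
      orbitComp fs k p = p := by
  have : NeZero k := ⟨hk.ne'⟩
  have hval : ∀ n : ℕ, ((n : ZMod k).val : ℤ) = (n : ℤ) % k := fun n => by
    rw [ZMod.val_natCast]; push_cast; rfl
  have hW : ∀ n : ℕ, Ws ((n : ZMod k).val : ℤ) = Ws n := fun n => by rw [hval, ← hWper]
  have hf : ∀ n : ℕ, fs ((n : ZMod k).val : ℤ) = fs n := fun n => by rw [hval, ← hfper]
  let W : ZMod k → Window M n₂ := fun i => Ws (i.val : ℤ)
  let f : ZMod k → M → M := fun i => fs (i.val : ℤ)
  have hal : ∀ i : ZMod k, CorrectlyAligned (W i) (W (i + 1)) (f i) := by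
    intro i
    have h := halign (i.val : ℤ)
    have e : Ws ((i.val : ℤ) + 1) = W (i + 1) := by
      have := hW (i.val + 1)
      push_cast at this
      rw [ZMod.natCast_zmod_val] at this
      exact this.symm
    rwa [e] at h
  let F : ZMod k → ℝ × (Fin n₂ → ℝ) → ℝ × (Fin n₂ → ℝ) :=
    fun i p => (W (i + 1)).χ.symm (f i ((W i).χ p))
  have htgt : ∀ i, ∀ p ∈ Cube n₂, f i ((W i).χ p) ∈ (W (i + 1)).χ.target := fun i p hp =>
    (hal i).2.1 ⟨_, (W i).χ.map_source ((W i).cube_subset hp), rfl⟩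
  have hχF : ∀ i, ∀ p ∈ Cube n₂, (W (i + 1)).χ (F i p) = f i ((W i).χ p) := fun i p hp =>
    (W (i + 1)).χ.right_inv (htgt i p hp)
  have hsub : ({0, 1} : Set ℝ) ×ˢ Icc (0 : Fin n₂ → ℝ) 1 ⊆ Cube n₂ := by
    refine prod_mono_left ?_
    rintro x (rfl | rfl) <;> simp
  obtain ⟨x, hx⟩ := exists_cyclic_orbit (Equiv.addRight (1 : ZMod k)) F
    (fun i => (W (i + 1)).χ.continuousOn_symm.comp
      ((hal i).1.comp_continuousOn ((W i).χ.continuousOn.mono (W i).cube_subset)) (htgt i))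
    (fun i p hp h => by
      have := (hal i).2.2.1
      exact this.le ⟨⟨_, ⟨p, hp, rfl⟩, rfl⟩, ⟨_, h, hχF i p (hsub hp)⟩⟩)
    (fun i p hp h => by
      have := (hal i).2.2.2.1
      exact this.le ⟨⟨_, ⟨p, hp, rfl⟩, rfl⟩, ⟨_, h, hχF i p hp⟩⟩)
    (fun i => (hal i).2.2.2.2)
  have horb : ∀ n : ℕ, orbitComp fs n ((W 0).χ (x 0)) = (W n).χ (x n) := by
    intro n
    induction n with
    | zero => simp [orbitComp]
    | succ n ih =>
      have h1 := hχF n (x n) (hx n).1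
      rw [(hx n).2] at h1
      simp only [orbitComp, Function.comp_apply, ih]
      rw [← hf n, Nat.cast_succ]
      exact h1.symm
  have hW0 : Ws 0 = W 0 := by simp [W]
  refine ⟨(W 0).χ (x 0), ?_, fun i => ?_, ?_⟩
  · rw [hW0]
    exact ⟨_, (hx 0).1, rfl⟩
  · rw [horb]
    have := hW (i + 1)
    rw [Nat.cast_succ (R := ℤ)] at this
    rw [← this]
    exact ⟨_, (hx _).1, rfl⟩
  · rw [horb]
    simp
end
end

section
/- Birkhoff's graph theorem for invariant essential circles: Let F be the map of the quotient annulus 𝕋¹ × [0,1] induced by f. If C ⊆ 𝕋¹ × [0,1] is an F-invariant set which is the image of a continuous injective loop γ : 𝕋¹ → 𝕋¹ × [0,1] that is not null-homotopic in 𝕋¹ × [0,1], then C is the graph of a Lipschitz function φ : 𝕋¹ → [0,1], i.e. C = {(x, φ(x)) : x ∈ 𝕋¹}. -/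
open Set Filter Topology

noncomputable section

/-- The closed annulus `A = ℝ × [0,1]` (universal cover of `𝕋¹ × [0,1]`). -/
def Ann : Set (ℝ × ℝ) := {p | p.2 ∈ Set.Icc (0:ℝ) 1}

/-- An area-preserving positive monotone twist map of the annulus, given together with
its inverse, as a lift to the universal cover `A = ℝ × [0,1]`. -/
structure AnnulusTwistMap where
  f : ℝ × ℝ → ℝ × ℝ
  finv : ℝ × ℝ → ℝ × ℝ
  smooth : ContDiffOn ℝ 1 f Ann
  smooth_inv : ContDiffOn ℝ 1 finv Ann
  maps : Set.MapsTo f Ann Ann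
  maps_inv : Set.MapsTo finv Ann Ann
  left_inv : ∀ p ∈ Ann, finv (f p) = p
  right_inv : ∀ p ∈ Ann, f (finv p) = p
  lift : ∀ p ∈ Ann, f (p.1 + 1, p.2) = f p + (1, 0)
  orient : ∀ p ∈ Ann, 0 < LinearMap.det ((fderivWithin ℝ f Ann p).toLinearMap)
  bottom : ∀ x : ℝ, (f (x, 0)).2 = 0
  top : ∀ x : ℝ, (f (x, 1)).2 = 1
  area : ∀ s ⊆ Ann, MeasurableSet s → MeasureTheory.volume (f '' s) = MeasureTheory.volume s
  twist : ∀ p ∈ Ann, 0 < derivWithin (fun y => (f (p.1, y)).1) (Set.Icc (0:ℝ) 1) p.2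

/-- The graph `{(x, φ(x)) : x ∈ ℝ}` of a function `φ`. -/
def torusGraph (φ : ℝ → ℝ) : Set (ℝ × ℝ) := {p | p.2 = φ p.1}

/-- `φ` defines an invariant primary torus (essential invariant circle) for `F`. -/
def IsPrimaryTorusFn (F : AnnulusTwistMap) (φ : ℝ → ℝ) : Prop :=
  (∃ K, LipschitzWith K φ) ∧ (∀ x, φ x ∈ Set.Icc (0:ℝ) 1) ∧ (∀ x, φ (x + 1) = φ x) ∧
    F.f '' torusGraph φ = torusGraph φ

/-- `T` is an invariant primary torus for `F`. -/
def IsPrimaryTorus (F : AnnulusTwistMap) (T : Set (ℝ × ℝ)) : Prop :=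
  ∃ φ, IsPrimaryTorusFn F φ ∧ T = torusGraph φ

/-- The closed region between the graphs of `φ₁` and `φ₂`. -/
def zone (φ₁ φ₂ : ℝ → ℝ) : Set (ℝ × ℝ) := {p | φ₁ p.1 ≤ p.2 ∧ p.2 ≤ φ₂ p.1}

/-- The open region strictly between the graphs of `φ₁` and `φ₂` (the interior of the zone). -/
def zoneInterior (φ₁ φ₂ : ℝ → ℝ) : Set (ℝ × ℝ) := {p | φ₁ p.1 < p.2 ∧ p.2 < φ₂ p.1}

/-- The region between the invariant primary tori `graph φ₁` and `graph φ₂` is a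
Birkhoff Zone of Instability. -/
def IsBZI (F : AnnulusTwistMap) (φ₁ φ₂ : ℝ → ℝ) : Prop :=
  IsPrimaryTorusFn F φ₁ ∧ IsPrimaryTorusFn F φ₂ ∧ (∀ x, φ₁ x < φ₂ x) ∧
    ∀ T, IsPrimaryTorus F T → ¬ T ⊆ zoneInterior φ₁ φ₂

/-- `z` has rotation number `ω`. -/
def HasRotNum (F : AnnulusTwistMap) (z : ℝ × ℝ) (ω : ℝ) : Prop :=
  Filter.Tendsto (fun n : ℕ => ((F.f)^[n] z).1 / n) Filter.atTop (nhds ω)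

/-- The `n`-th iterate of `F` for `n : ℤ`. -/
def iterZ (F : AnnulusTwistMap) (n : ℤ) (z : ℝ × ℝ) : ℝ × ℝ :=
  if 0 ≤ n then (F.f)^[n.toNat] z else (F.finv)^[(-n).toNat] z

/-- The extended orbit `EO(z) = {fⁿ(z) + (j,0) : n, j ∈ ℤ}`. -/
def extOrbit (F : AnnulusTwistMap) (z : ℝ × ℝ) : Set (ℝ × ℝ) :=
  {w | ∃ n j : ℤ, w = iterZ F n z + ((j : ℝ), 0)}

/-- A monotone (cyclically ordered) set. -/
def IsMonotoneSet (F : AnnulusTwistMap) (M : Set (ℝ × ℝ)) : Prop :=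
  ∀ z₁ ∈ M, ∀ z₂ ∈ M, z₁.1 < z₂.1 → (F.f z₁).1 < (F.f z₂).1

/-- An Aubry-Mather set of rotation number `ω`: a nonempty, closed, invariant, monotone,
minimal subset of `Rot(ω)`. -/
def IsAubryMather (F : AnnulusTwistMap) (ω : ℝ) (S : Set (ℝ × ℝ)) : Prop :=
  S.Nonempty ∧ IsClosed S ∧ F.f '' S = S ∧ IsMonotoneSet F S ∧
    (∀ z ∈ S, HasRotNum F z ω) ∧
    ∀ S' ⊆ S, S'.Nonempty → IsClosed S' → F.f '' S' = S' → S' = S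

/-- The circle `𝕋¹ = ℝ/ℤ`. -/
abbrev Circle1 := AddCircle (1 : ℝ)

/-- The quotient annulus `𝕋¹ × [0,1]`, as a subset of `𝕋¹ × ℝ`. -/
def AnnQ : Set (Circle1 × ℝ) := {p | p.2 ∈ Set.Icc (0:ℝ) 1}

section Preliminaries

open MeasureTheory

/-- The closed strip `ℝ × [0,1]` as a type. -/
abbrev Strip := ℝ × unitInterval

/-- The reflection `(x, y) ↦ (-x, y)` of the strip. -/
def stripRefl : Strip ≃ₜ Strip := (Homeomorph.neg ℝ).prodCongr (Homeomorph.refl _)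

lemma stripRefl_apply (p : Strip) : stripRefl p = (-p.1, p.2) := rfl

@[simp] lemma stripRefl_stripRefl (p : Strip) : stripRefl (stripRefl p) = p := by
  simp [stripRefl_apply]

/-- The conjugate of the inverse of `f` by the reflection. It is again a positive twist map. -/
def stripRev (f : Strip ≃ₜ Strip) : Strip ≃ₜ Strip := stripRefl.trans (f.symm.trans stripRefl)

lemma stripRev_apply (f : Strip ≃ₜ Strip) (p : Strip) :
    stripRev f p = (-(f.symm (-p.1, p.2)).1, (f.symm (-p.1, p.2)).2) := rfl

lemma stripRev_stripRev (f : Strip ≃ₜ Strip) : stripRev (stripRev f) = f := by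
  ext p : 1
  have h : (stripRev f).symm (-p.1, p.2) = stripRefl (f p) := by
    rw [Homeomorph.symm_apply_eq]
    simp [stripRev, ← stripRefl_apply]
  rw [stripRev_apply, h]
  simp [stripRefl_apply]

/-- Area-preserving positive twist homeomorphisms of the strip commuting with the unit
translation, with twist constant `κ` and horizontal Lipschitz constant `L`. -/
structure IsStripTwist (f : Strip ≃ₜ Strip) (κ L : ℝ) : Prop where
  pos : 0 < κ
  lift : ∀ p : Strip, f (p.1 + 1, p.2) = ((f p).1 + 1, (f p).2)
  bottom : ∀ x : ℝ, (f (x, 0)).2 = 0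
  top : ∀ x : ℝ, (f (x, 1)).2 = 1
  area : MeasurePreserving f volume volume
  twist : ∀ (x : ℝ) (y₁ y₂ : unitInterval), y₁ ≤ y₂ →
    κ * (y₂ - y₁ : ℝ) ≤ (f (x, y₂)).1 - (f (x, y₁)).1
  lip : ∀ (x₁ x₂ : ℝ) (y : unitInterval), |x₁ - x₂| ≤ 1 →
    |(f (x₁, y)).1 - (f (x₂, y)).1| ≤ L * |x₁ - x₂|

/-- Closed, periodic, `f`-invariant subsets of the strip in which every point lies on a path
running across the whole strip. -/
structure IsEssInvariant (f : Strip ≃ₜ Strip) (C : Set Strip) : Prop where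
  closed : IsClosed C
  nonempty : C.Nonempty
  periodic : ∀ p : Strip, (p.1 + 1, p.2) ∈ C ↔ p ∈ C
  inv : ∀ p, f p ∈ C ↔ p ∈ C
  path : ∀ c ∈ C, ∃ δ : ℝ → Strip, Continuous δ ∧ (∀ t, δ t ∈ C) ∧ (∃ t, δ t = c) ∧
    Function.Surjective fun t => (δ t).1

/-- The points of the strip that are vertically accessible from below in the complement
of `C`. -/
def belowSet (C : Set Strip) : Set Strip := {p | ∀ y ≤ p.2, (p.1, y) ∉ C}

lemma belowSet_of_snd_le {C : Set Strip} {x : ℝ} {y y' : unitInterval}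
    (h : (x, y) ∈ belowSet C) (hy : y' ≤ y) : (x, y') ∈ belowSet C :=
  fun z hz => h z (hz.trans hy)

namespace IsEssInvariant

variable {f : Strip ≃ₜ Strip} {C : Set Strip}

lemma rev (hC : IsEssInvariant f C) : IsEssInvariant (stripRev f) (stripRefl ⁻¹' C) where
  closed := hC.closed.preimage stripRefl.continuous
  nonempty := hC.nonempty.preimage stripRefl.surjective
  periodic p := by
    have := hC.periodic (-p.1 - 1, p.2)
    simp only [sub_add_cancel] at this
    change (-(p.1 + 1), p.2) ∈ C ↔ (-p.1, p.2) ∈ C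
    rw [this, neg_add']
  inv p := by
    simp only [mem_preimage, stripRev, Homeomorph.trans_apply, stripRefl_stripRefl]
    rw [← hC.inv, Homeomorph.apply_symm_apply]
  path c hc := by
    obtain ⟨δ, hδ, hδC, ⟨t, ht⟩, hs⟩ := hC.path _ hc
    refine ⟨fun t => stripRefl (δ t), stripRefl.continuous.comp hδ, fun t => ?_, ⟨t, ?_⟩,
      fun x => ?_⟩
    · simpa using hδC t
    · simp [ht]
    · obtain ⟨t, ht⟩ := hs (-x)
      exact ⟨t, by simp_all [stripRefl_apply]⟩

lemma exists_mem_vertical (hC : IsEssInvariant f C) (x : ℝ) : ∃ y, (x, y) ∈ C := by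
  obtain ⟨c, hc⟩ := hC.nonempty
  obtain ⟨δ, -, hδC, -, hs⟩ := hC.path c hc
  obtain ⟨t, ht⟩ := hs x
  exact ⟨(δ t).2, by subst ht; exact hδC t⟩

lemma exists_lowest (hC : IsEssInvariant f C) (x : ℝ) :
    ∃ y, (x, y) ∈ C ∧ ∀ y' < y, (x, y') ∉ C := by
  have hcl : IsClosed {y : unitInterval | (x, y) ∈ C} :=
    hC.closed.preimage (Continuous.prodMk_right x)
  obtain ⟨y, hy, hmin⟩ := hcl.isCompact.exists_isLeast (hC.exists_mem_vertical x)
  exact ⟨y, hy, fun y' hy' h => (hmin h).not_gt hy'⟩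

lemma isOpen_belowSet (hC : IsEssInvariant f C) : IsOpen (belowSet C) := by
  have hcl : IsClosed {q : Strip × unitInterval | q.2 ≤ q.1.2 ∧ (q.1.1, q.2) ∈ C} :=
    (isClosed_le continuous_snd (by fun_prop)).inter (hC.closed.preimage (by fun_prop))
  have := isClosedMap_fst_of_compactSpace _ hcl
  rw [← isClosed_compl_iff]
  convert this using 1
  ext p
  constructor
  · intro h
    simp only [belowSet, mem_compl_iff, mem_ofPred_eq] at h
    push Not at h
    obtain ⟨y, hy, hyC⟩ := h
    exact ⟨(p, y), ⟨hy, hyC⟩, rfl⟩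
  · rintro ⟨⟨q, y⟩, ⟨hy, hyC⟩, rfl⟩ h
    exact h y hy hyC

lemma belowSet_snd_lt (hC : IsEssInvariant f C) {p : Strip} (hp : p ∈ belowSet C) :
    p.2 < 1 := by
  by_contra! h
  obtain ⟨y, hy⟩ := hC.exists_mem_vertical p.1
  exact hp y (unitInterval.le_one'.trans h) hy

/-- A closed bounded set cannot meet `C` in a nonempty relatively open set. -/
lemma notMem_of_nhds (hC : IsEssInvariant f C) {K : Set Strip} (hK : IsClosed K) {B : ℝ}
    (hB : ∀ p ∈ K, p.1 ≤ B) (hn : ∀ c ∈ C, c ∈ K → K ∈ 𝓝 c) : ∀ c ∈ C, c ∉ K := by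
  intro c hc hcK
  obtain ⟨δ, hδ, hδC, ⟨t, rfl⟩, hs⟩ := hC.path c hc
  have hclopen : IsClopen (δ ⁻¹' K) := by
    refine ⟨hK.preimage hδ, isOpen_iff_mem_nhds.2 fun s hs => ?_⟩
    exact hδ.continuousAt (hn _ (hδC s) hs)
  have huniv := hclopen.eq_univ ⟨t, hcK⟩
  obtain ⟨s, hs⟩ := hs (B + 1)
  have : s ∈ δ ⁻¹' K := huniv ▸ mem_univ s
  have := hB _ this
  simp only at hs
  linarith

end IsEssInvariant

namespace IsStripTwist

variable {f : Strip ≃ₜ Strip} {κ L : ℝ}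

lemma strictMono (hf : IsStripTwist f κ L) (x : ℝ) : StrictMono fun y => (f (x, y)).1 := by
  intro y₁ y₂ h
  have h1 := hf.twist x y₁ y₂ h.le
  have h2 : 0 < (y₂ - y₁ : ℝ) := sub_pos.2 h
  have := mul_pos hf.pos h2
  simp only
  linarith

lemma symm_strictAnti (hf : IsStripTwist (stripRev f) κ L) (x : ℝ) :
    StrictAnti fun y => (f.symm (x, y)).1 := by
  intro y₁ y₂ h
  have := hf.strictMono (-x) h
  simpa [stripRev_apply] using this

lemma exists_displacement_le (hf : IsStripTwist f κ L) : ∃ B, ∀ p, |(f p).1 - p.1| ≤ B := by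
  have hcont : Continuous fun p : Strip => |(f p).1 - p.1| := by fun_prop
  obtain ⟨B, hB⟩ := ((isCompact_Icc (a := (0 : ℝ)) (b := 1)).prod
    (isCompact_univ (X := unitInterval))).bddAbove_image hcont.continuousOn
  refine ⟨B, fun p => ?_⟩
  have hper : Function.Periodic (fun x => |(f (x, p.2)).1 - x|) 1 := by
    intro x
    have := hf.lift (x, p.2)
    simp only at this
    simp [this]
  obtain ⟨x, hx, hxp⟩ := hper.exists_mem_Ico₀ one_pos p.1
  have := hB (mem_image_of_mem _ (show (x, p.2) ∈ Icc (0 : ℝ) 1 ×ˢ univ from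
    ⟨Ico_subset_Icc_self hx, mem_univ _⟩))
  exact hxp.trans_le this

end IsStripTwist

/-- `q` is the top of a vertical segment bounding on its right a region whose frontier meets
`C` only along that segment. -/
def LeftAccessible (C : Set Strip) (q : Strip) : Prop :=
  ∃ Δ : Set Strip, IsClosed Δ ∧ (∃ B, ∀ p ∈ Δ, |p.1| ≤ B) ∧ q ∉ C ∧
    (∀ c ∈ C, c ∈ Δ → Δ ∈ 𝓝 c ∨ (c.1 = q.1 ∧ c.2 ≤ q.2)) ∧
    ∀ c ∈ C, c.1 = q.1 → c.2 ≤ q.2 → Δ ∈ 𝓝[{p | p.1 ≤ q.1}] c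

section Accessible

variable {f : Strip ≃ₜ Strip} {C : Set Strip} {κ L : ℝ}

lemma leftAccessible_of_mem_belowSet {q : Strip} (hq : q ∈ belowSet C) :
    LeftAccessible C q :=
  ⟨∅, isClosed_empty, ⟨0, by simp⟩, hq q.2 le_rfl, by simp, fun c hc h1 h2 =>
    absurd hc (by have := hq c.2 h2; rwa [← h1] at this)⟩

lemma LeftAccessible.map (hf : IsStripTwist f κ L) (hr : IsStripTwist (stripRev f) κ L)
    (hC : IsEssInvariant f C) {q : Strip} (hq : LeftAccessible C q) :
    LeftAccessible C (f q) := by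
  obtain ⟨Δ, hΔ, ⟨B, hB⟩, hqC, hint, hvert⟩ := hq
  obtain ⟨B', hB'⟩ := hf.exists_displacement_le
  have hB'' (p : Strip) : |p.1 - (f.symm p).1| ≤ B' := by simpa using hB' (f.symm p)
  set T : Set Strip := {p | p.1 ≤ (f q).1 ∧ q.1 ≤ (f.symm p).1} with hT
  have hTcl : IsClosed T :=
    (isClosed_le continuous_fst continuous_const).inter
      (isClosed_le continuous_const (continuous_fst.comp f.symm.continuous))
  -- points of `C` inside the triangle
  have hkey : ∀ c ∈ C, c.1 ≤ (f q).1 → q.1 ≤ (f.symm c).1 →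
      (f '' Δ ∪ T) ∈ 𝓝 c ∨ (c.1 = (f q).1 ∧ c.2 ≤ (f q).2) := by
    intro c hc h1 h2
    have hdC : f.symm c ∈ C := by rw [← hC.inv]; simpa using hc
    rcases h1.eq_or_lt with h1 | h1
    · right
      refine ⟨h1, ?_⟩
      by_contra! h
      have := IsStripTwist.symm_strictAnti hr (f q).1 h
      simp only [← h1, Prod.mk.eta] at this
      rw [h1, Prod.mk.eta, Homeomorph.symm_apply_apply] at this
      exact absurd h2 this.not_ge
    left
    have hopen : ∀ᶠ p in 𝓝 c, p.1 < (f q).1 :=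
      (isOpen_lt continuous_fst continuous_const).mem_nhds h1
    rcases h2.eq_or_lt with h2 | h2
    · have hlt : (f.symm c).2 ≤ q.2 := by
        by_contra! h
        have := hf.strictMono q.1 h
        simp only [Prod.mk.eta] at this
        rw [h2, Prod.mk.eta, Homeomorph.apply_symm_apply] at this
        linarith
      have := hvert _ hdC h2.symm hlt
      rw [mem_nhdsWithin_iff_eventually] at this
      have := f.symm.continuous.continuousAt.eventually this
      filter_upwards [hopen, this] with p hp1 hp2
      by_cases h : (f.symm p).1 ≤ q.1
      · exact Or.inl ⟨f.symm p, hp2 h, by simp⟩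
      · exact Or.inr ⟨hp1.le, (not_le.1 h).le⟩
    · have hopen' : ∀ᶠ p in 𝓝 c, q.1 < (f.symm p).1 :=
        (isOpen_lt continuous_const (by fun_prop)).mem_nhds h2
      filter_upwards [hopen, hopen'] with p hp1 hp2
      exact Or.inr ⟨hp1.le, hp2.le⟩
  refine ⟨f '' Δ ∪ T, (f.isClosedMap _ hΔ).union hTcl,
    ⟨max (B + B') (max |(f q).1| (|q.1| + B')), ?_⟩, by rwa [hC.inv], ?_, ?_⟩
  · rintro p (⟨p, hp, rfl⟩ | ⟨h1, h2⟩)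
    · refine le_max_of_le_left ?_
      have := hB' p
      have := hB p hp
      rw [abs_le] at *
      constructor <;> linarith
    · refine le_max_of_le_right ?_
      have := hB'' p
      rw [abs_le] at this
      rw [le_max_iff, abs_le, abs_le]
      have := neg_abs_le q.1
      have := le_abs_self (f q).1
      have := neg_abs_le (f q).1
      have := abs_nonneg q.1
      rcases le_or_gt 0 p.1 with h | h
      · left; constructor <;> linarith
      · right; constructor <;> linarith
  · rintro c hc (⟨d, hd, rfl⟩ | ⟨h1, h2⟩)
    · have hdC : d ∈ C := (hC.inv d).1 hc
      rcases hint d hdC hd with h | ⟨h1, h2⟩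
      · left
        refine mem_of_superset ?_ subset_union_left
        exact f.isOpenMap.image_mem_nhds h
      · refine hkey _ hc ?_ (by simp [h1])
        have := (hf.strictMono q.1).monotone h2
        simp only [← h1, Prod.mk.eta] at this
        rwa [h1] at this
    · exact hkey c hc h1 h2
  · intro c hc h1 h2
    have hne : c.2 ≠ (f q).2 := by
      intro h
      have : c = f q := Prod.ext h1 h
      rw [this, hC.inv] at hc
      exact hqC hc
    have := IsStripTwist.symm_strictAnti hr (f q).1 (h2.lt_of_ne hne)
    simp only [Prod.mk.eta, Homeomorph.symm_apply_apply] at this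
    rw [← h1, Prod.mk.eta] at this
    have hopen' : ∀ᶠ p in 𝓝 c, q.1 < (f.symm p).1 :=
      (isOpen_lt continuous_const (by fun_prop)).mem_nhds this
    rw [mem_nhdsWithin_iff_eventually]
    filter_upwards [hopen'] with p hp1 hp2
    exact Or.inr ⟨hp2, hp1.le⟩

/-- A point accessible from both sides is vertically accessible. -/
lemma mem_belowSet_of_leftAccessible (hC : IsEssInvariant f C) {q : Strip}
    (hl : LeftAccessible C q) (hr : LeftAccessible (stripRefl ⁻¹' C) (stripRefl q)) :
    q ∈ belowSet C := by
  obtain ⟨Δ, hΔ, ⟨B, hB⟩, hqC, hint, hvert⟩ := hl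
  obtain ⟨Δ', hΔ', ⟨B', hB'⟩, -, hint', hvert'⟩ := hr
  have hv : ∀ c ∈ C, c.1 = q.1 → c.2 ≤ q.2 → Δ ∪ stripRefl ⁻¹' Δ' ∈ 𝓝 c := by
    intro c hc h1 h2
    have e1 := hvert c hc h1 h2
    have e2 := hvert' (stripRefl c) (by simpa using hc) (by simp [stripRefl_apply, h1]) h2
    rw [mem_nhdsWithin_iff_eventually] at e1 e2
    have e2 := stripRefl.continuous.continuousAt.eventually e2
    filter_upwards [e1, e2] with p hp1 hp2
    rcases le_total p.1 q.1 with h | h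
    · exact Or.inl (hp1 h)
    · exact Or.inr (hp2 (by simpa [stripRefl_apply] using h))
  have := hC.notMem_of_nhds (K := Δ ∪ stripRefl ⁻¹' Δ') (B := max B B')
    (hΔ.union (hΔ'.preimage stripRefl.continuous)) ?_ ?_
  · intro y hy hyC
    exact this _ hyC (mem_of_mem_nhds (hv _ hyC rfl hy))
  · rintro p (hp | hp)
    · exact le_max_of_le_left ((le_abs_self _).trans (hB p hp))
    · refine le_max_of_le_right ((le_abs_self _).trans ?_)
      simpa [stripRefl_apply] using hB' _ hp
  · rintro c hc (hcΔ | hcΔ)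
    · rcases hint c hc hcΔ with h | ⟨h1, h2⟩
      · exact mem_of_superset h subset_union_left
      · exact hv c hc h1 h2
    · rcases hint' _ (by simpa using hc) hcΔ with h | ⟨h1, h2⟩
      · have := stripRefl.continuous.continuousAt.preimage_mem_nhds h
        exact mem_of_superset this subset_union_right
      · exact hv c hc (by simpa [stripRefl_apply] using h1) h2

/-- Along an orbit, the times spent in `belowSet C` form an interval. -/
lemma mem_belowSet_of_iterate (hf : IsStripTwist f κ L) (hr : IsStripTwist (stripRev f) κ L)
    (hC : IsEssInvariant f C) {p : Strip} (hp : p ∈ belowSet C) (m n : ℕ)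
    (hp' : f^[n] (f^[m] p) ∈ belowSet C) : f^[m] p ∈ belowSet C := by
  have hl : ∀ m, LeftAccessible C (f^[m] p) := by
    intro m
    induction m with
    | zero => exact leftAccessible_of_mem_belowSet hp
    | succ m ih => rw [Function.iterate_succ_apply']; exact ih.map hf hr hC
  have hl' : ∀ n q, f^[n] q ∈ belowSet C →
      LeftAccessible (stripRefl ⁻¹' C) (stripRefl q) := by
    intro n
    induction n with
    | zero => exact fun q hq => leftAccessible_of_mem_belowSet
                (by simpa [belowSet, stripRefl_apply] using hq)
    | succ n ih =>
      intro q hq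
      rw [Function.iterate_succ_apply] at hq
      have := (ih _ hq).map hr (by rwa [stripRev_stripRev]) hC.rev
      simpa [stripRev] using this
  exact mem_belowSet_of_leftAccessible hC (hl m) (hl' n _ hp')

end Accessible

section Wandering

variable {f : Strip ≃ₜ Strip} {κ L : ℝ}

lemma periodic_int {D : Set Strip} (hper : ∀ p : Strip, (p.1 + 1, p.2) ∈ D ↔ p ∈ D)
    (p : Strip) (n : ℤ) : (p.1 + n, p.2) ∈ D ↔ p ∈ D := by
  have h : Function.Periodic (fun x : ℝ => (x, p.2) ∈ D) 1 :=
    fun x => propext (hper (x, p.2))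
  simpa using (h.int_mul n p.1).to_iff

/-- The part of the strip over the interval `[a, b)`. -/
def stripSlice (a b : ℝ) : Set Strip := Ico a b ×ˢ univ

lemma measurableSet_stripSlice (a b : ℝ) : MeasurableSet (stripSlice a b) :=
  measurableSet_Ico.prod MeasurableSet.univ

lemma volume_stripSlice (a b : ℝ) : volume (stripSlice a b) = ENNReal.ofReal (b - a) := by
  rw [stripSlice, Measure.volume_eq_prod, Measure.prod_prod]
  simp

lemma volume_inter_stripSlice_int {D : Set Strip} (hD : MeasurableSet D)
    (hper : ∀ p : Strip, (p.1 + 1, p.2) ∈ D ↔ p ∈ D) (n : ℤ) :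
    volume (D ∩ stripSlice n (n + 1)) = volume (D ∩ stripSlice 0 1) := by
  have hT : MeasurePreserving (Prod.map (· + (n : ℝ)) id : Strip → Strip) volume volume :=
    (measurePreserving_add_right volume (n : ℝ)).prod (MeasurePreserving.id volume)
  rw [← hT.measure_preimage (hD.inter (measurableSet_stripSlice _ _)).nullMeasurableSet]
  congr 1
  ext p
  have := periodic_int hper p n
  simp only [mem_preimage, mem_inter_iff, stripSlice, mem_prod, Prod.map_fst, Prod.map_snd,
    mem_univ, and_true, mem_Ico, id]
  rw [show Prod.map (· + (n : ℝ)) id p = (p.1 + n, p.2) from rfl, this]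
  refine and_congr_right fun _ => ⟨fun h => ⟨?_, ?_⟩, fun h => ⟨?_, ?_⟩⟩ <;> linarith [h.1, h.2]

lemma natCast_mul_volume_le {D : Set Strip} (hD : MeasurableSet D)
    (hper : ∀ p : Strip, (p.1 + 1, p.2) ∈ D ↔ p ∈ D) (N : ℕ) :
    N * volume (D ∩ stripSlice 0 1) ≤ volume (D ∩ stripSlice 0 N) := by
  have hdisj : ((Finset.range N : Finset ℕ) : Set ℕ).PairwiseDisjoint
      fun i => D ∩ stripSlice ((i : ℤ) : ℝ) ((i : ℤ) + 1) := by
    intro i _ j _ hij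
    rw [Function.onFun, Set.disjoint_left]
    rintro p ⟨-, ⟨h1, h2⟩, -⟩ ⟨-, ⟨h3, h4⟩, -⟩
    have h5 : (i : ℝ) < j + 1 := by push_cast at *; linarith
    have h6 : (j : ℝ) < i + 1 := by push_cast at *; linarith
    norm_cast at h5 h6
    omega
  have := measure_biUnion_finset (μ := volume) hdisj
    fun i _ => hD.inter (measurableSet_stripSlice _ _)
  simp only [volume_inter_stripSlice_int hD hper, Finset.sum_const, Finset.card_range,
    nsmul_eq_mul] at this
  rw [← this]
  refine measure_mono (iUnion₂_subset fun i hi => inter_subset_inter_right _ ?_)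
  refine prod_mono_left (Ico_subset_Ico (by simp) ?_)
  have : i + 1 ≤ N := Finset.mem_range.1 hi
  exact_mod_cast this

/-- Periodic wandering sets are null. -/
lemma IsStripTwist.volume_eq_zero_of_wandering (hf : IsStripTwist f κ L) {D : Set Strip}
    (hD : MeasurableSet D) (hper : ∀ p : Strip, (p.1 + 1, p.2) ∈ D ↔ p ∈ D)
    (hw : ∀ n, ∀ p ∈ D, f^[n + 1] p ∉ D) : volume D = 0 := by
  set d := volume (D ∩ stripSlice 0 1) with hd
  have hd1 : d ≤ 1 := (measure_mono inter_subset_right).trans (by simp [volume_stripSlice])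
  obtain ⟨B, hB⟩ := hf.exists_displacement_le
  have hB0 : 0 ≤ B := (abs_nonneg _).trans (hB (0, 0))
  have hBn : ∀ (n : ℕ) p, |(f^[n] p).1 - p.1| ≤ n * B := by
    intro n
    induction n with
    | zero => simp
    | succ n ih =>
      intro p
      rw [Function.iterate_succ_apply']
      have h1 := ih p
      have h2 := hB (f^[n] p)
      rw [abs_le] at *
      push_cast
      constructor <;> linarith
  have hbound : ∀ k N : ℕ, k * (N * d) ≤ ENNReal.ofReal (N + 2 * k * B) := by
    intro k N
    have hdisj : ((Finset.range k : Finset ℕ) : Set ℕ).PairwiseDisjoint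
        fun i => f^[i] ⁻¹' (D ∩ stripSlice 0 N) := by
      have key : ∀ i j, i < j →
          Disjoint (f^[i] ⁻¹' (D ∩ stripSlice 0 N)) (f^[j] ⁻¹' (D ∩ stripSlice 0 N)) := by
        intro i j hij
        rw [Set.disjoint_left]
        rintro p ⟨h1, -⟩ ⟨h2, -⟩
        obtain ⟨m, rfl⟩ := Nat.exists_eq_add_of_lt hij
        refine hw m _ h1 ?_
        rwa [← Function.iterate_add_apply, show m + 1 + i = i + m + 1 by ring]
      intro i _ j _ hij
      rcases hij.lt_or_gt with h | h
      · exact key i j h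
      · exact (key j i h).symm
    have hmeas := hD.inter (measurableSet_stripSlice 0 N)
    have := measure_biUnion_finset (μ := volume) hdisj
      fun i _ => (hf.area.iterate i).measurable hmeas
    simp only [(hf.area.iterate _).measure_preimage hmeas.nullMeasurableSet, Finset.sum_const,
      Finset.card_range, nsmul_eq_mul] at this
    calc (k : ENNReal) * (N * d) ≤ k * volume (D ∩ stripSlice 0 N) := by
          gcongr; exact natCast_mul_volume_le hD hper N
      _ = _ := this.symm
      _ ≤ volume (stripSlice (-(k * B)) (N + k * B)) := by
          refine measure_mono (iUnion₂_subset fun i hi => ?_)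
          rintro p ⟨-, ⟨h1, h2⟩, -⟩
          have h3 := hBn i p
          have h4 : (i : ℝ) * B ≤ k * B := by
            gcongr; exact (Finset.mem_range.1 hi).le
          rw [abs_le] at h3
          exact ⟨⟨by linarith, by linarith⟩, mem_univ _⟩
      _ = _ := by rw [volume_stripSlice]; congr 1; ring
  have hd0 : d = 0 := by
    by_contra hne
    have hpos : 0 < d.toReal := ENNReal.toReal_pos hne (hd1.trans_lt ENNReal.one_lt_top).ne
    obtain ⟨k, hk⟩ := exists_nat_gt (2 / d.toReal)
    obtain ⟨N, hN⟩ := exists_nat_gt (2 * k * B)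
    have h1 := ENNReal.toReal_mono ENNReal.ofReal_ne_top (hbound k N)
    rw [ENNReal.toReal_ofReal (by positivity)] at h1
    simp only [ENNReal.toReal_mul, ENNReal.toReal_natCast] at h1
    rw [div_lt_iff₀ hpos] at hk
    have h2 : 0 < (N : ℝ) := lt_of_le_of_lt (by positivity) hN
    nlinarith
  have hcover : D ⊆ ⋃ n : ℤ, D ∩ stripSlice n (n + 1) := fun p hp =>
    mem_iUnion.2 ⟨⌊p.1⌋, hp, ⟨Int.floor_le _, Int.lt_floor_add_one _⟩, mem_univ _⟩
  refine measure_mono_null hcover (measure_iUnion_null fun n => ?_)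
  rw [volume_inter_stripSlice_int hD hper, ← hd, hd0]

end Wandering

section Graph

variable {f : Strip ≃ₜ Strip} {C : Set Strip} {κ L : ℝ}

lemma IsStripTwist.symm_lift (hf : IsStripTwist f κ L) (p : Strip) :
    f.symm (p.1 + 1, p.2) = ((f.symm p).1 + 1, (f.symm p).2) := by
  rw [Homeomorph.symm_apply_eq, hf.lift]
  simp

lemma volume_image_diff_belowSet (hf : IsStripTwist f κ L)
    (hr : IsStripTwist (stripRev f) κ L) (hC : IsEssInvariant f C) :
    volume (f '' belowSet C \ belowSet C) = 0 := by
  have hper : ∀ p : Strip, (p.1 + 1, p.2) ∈ belowSet C ↔ p ∈ belowSet C := fun p =>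
    forall₂_congr fun y _ => (hC.periodic (p.1, y)).not
  refine hf.volume_eq_zero_of_wandering ?_ (fun p => ?_) ?_
  · exact (f.isOpenMap _ hC.isOpen_belowSet).measurableSet.diff
      hC.isOpen_belowSet.measurableSet
  · rw [Set.mem_sdiff, Set.mem_sdiff, hper, Homeomorph.image_eq_preimage_symm, mem_preimage,
      mem_preimage, hf.symm_lift, hper]
  · rintro n _ ⟨⟨p, hp, rfl⟩, hfp⟩ ⟨⟨q, hq, hq'⟩, -⟩
    rw [Function.iterate_succ_apply'] at hq'
    have := f.injective hq'
    exact hfp (mem_belowSet_of_iterate hf hr hC hp 1 n (by rwa [Function.iterate_one, ← this]))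

/-- Points off the upper boundary line stay off it. -/
lemma IsStripTwist.snd_lt_one_of_rev (hr : IsStripTwist (stripRev f) κ L) {p : Strip}
    (hp : p.2 < 1) : (f p).2 < 1 := by
  refine lt_of_le_of_ne unitInterval.le_one' fun h => ?_
  have h1 := hr.top (-(f p).1)
  rw [stripRev_apply] at h1
  simp only [neg_neg] at h1
  rw [show ((f p).1, (1 : unitInterval)) = f p by rw [← h],
    Homeomorph.symm_apply_apply] at h1
  exact hp.ne h1

lemma image_belowSet_subset (hf : IsStripTwist f κ L)
    (hr : IsStripTwist (stripRev f) κ L) (hC : IsEssInvariant f C) {p : Strip}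
    (hp : p ∈ belowSet C) : f p ∈ belowSet C := by
  have hnull := volume_image_diff_belowSet hf hr hC
  have hopen : IsOpen (f '' belowSet C) := f.isOpenMap _ hC.isOpen_belowSet
  have hmem : f p ∈ f '' belowSet C := mem_image_of_mem f hp
  have hqC : f p ∉ C := by rw [hC.inv]; exact hp p.2 le_rfl
  have hlt : (f p).2 < 1 := hr.snd_lt_one_of_rev (hC.belowSet_snd_lt hp)
  generalize f p = q at *
  by_contra hq
  simp only [belowSet, mem_ofPred_eq] at hq
  push Not at hq
  obtain ⟨η, hη, hηC⟩ := hq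
  obtain ⟨U, hU, W, hW, hUW⟩ := mem_nhds_prod_iff.1 (hopen.mem_nhds hmem)
  obtain ⟨δ, hδ, hδC, ⟨t₀, ht₀⟩, hs⟩ := hC.path _ hηC
  obtain ⟨ε, hε, hεU⟩ := Metric.mem_nhds_iff.1 hU
  obtain ⟨z, hz, hzW⟩ := exists_Ico_subset_of_mem_nhds hW ⟨1, hlt⟩
  -- vertically accessible points are dense
  have hdense : ∀ a b, a < b → Ioo a b ⊆ Metric.ball q.1 ε → ∃ x ∈ Ioo a b,
      (x, q.2) ∈ belowSet C := by
    intro a b hab hsub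
    have hpos : volume (Ioo a b ×ˢ Ioo q.2 z) ≠ 0 := by
      rw [Measure.volume_eq_prod, Measure.prod_prod]
      simpa [hab] using hz
    by_contra! hcon
    refine hpos (measure_mono_null ?_ hnull)
    rintro ⟨x, y⟩ ⟨hx, hy⟩
    refine ⟨hUW ⟨hεU (hsub hx), hzW ⟨hy.1.le, hy.2⟩⟩, fun h => hcon x hx ?_⟩
    exact belowSet_of_snd_le h hy.1.le
  -- the part of the path hanging below `q` is both open and closed
  have hclopen : IsClopen {t | (δ t).1 = q.1 ∧ (δ t).2 < q.2} := by
    constructor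
    · have : {t | (δ t).1 = q.1 ∧ (δ t).2 < q.2} = {t | (δ t).1 = q.1 ∧ (δ t).2 ≤ q.2} := by
        ext t
        refine and_congr_right fun h1 => ⟨le_of_lt, fun h2 => h2.lt_of_ne fun h3 => hqC ?_⟩
        rw [← show δ t = q from Prod.ext h1 h3]
        exact hδC t
      rw [this]
      exact (isClosed_eq (by fun_prop) continuous_const).inter
        (isClosed_le (by fun_prop) continuous_const)
    · rw [isOpen_iff_mem_nhds]
      rintro t ⟨h1, h2⟩
      have e1 : ∀ᶠ s in 𝓝 t, (δ s).1 ∈ Metric.ball q.1 ε :=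
        hδ.fst.continuousAt.preimage_mem_nhds (by rw [h1]; exact Metric.ball_mem_nhds _ hε)
      have e2 : ∀ᶠ s in 𝓝 t, (δ s).2 < q.2 :=
        (isOpen_lt (by fun_prop) continuous_const).mem_nhds h2
      obtain ⟨r, hr, hball⟩ := Metric.mem_nhds_iff.1 (e1.and e2)
      refine mem_of_superset (Metric.ball_mem_nhds t hr) fun s hs => ⟨?_, (hball hs).2⟩
      by_contra hne
      have hoc : OrdConnected ((fun s => (δ s).1) '' Metric.ball t r) :=
        ((convex_ball t r).isPreconnected.image _ hδ.fst.continuousOn).ordConnected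
      have hsub : uIcc (δ s).1 q.1 ⊆ (fun s => (δ s).1) '' Metric.ball t r :=
        hoc.uIcc_subset ⟨s, hs, rfl⟩ ⟨t, Metric.mem_ball_self hr, h1⟩
      obtain ⟨x, hx, hxV⟩ := hdense ((δ s).1 ⊓ q.1) ((δ s).1 ⊔ q.1) (inf_lt_sup.2 hne)
        (fun x hx => by
          obtain ⟨s', hs', rfl⟩ := hsub (Ioo_subset_Icc_self hx)
          exact (hball hs').1)
      obtain ⟨s', hs', rfl⟩ := hsub (Ioo_subset_Icc_self hx)
      exact hxV _ (hball hs').2.le (hδC s')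
  have huniv := hclopen.eq_univ ⟨t₀, by
    rw [mem_ofPred_eq, ht₀]
    exact ⟨rfl, hη.lt_of_ne fun h => hqC (by rwa [h] at hηC)⟩⟩
  obtain ⟨t, ht⟩ := hs (q.1 + 1)
  have h1 : (δ t).1 = q.1 := (huniv ▸ mem_univ t : t ∈ {t | (δ t).1 = q.1 ∧ (δ t).2 < q.2}).1
  simp only at ht
  linarith

lemma mem_belowSet_iff (hf : IsStripTwist f κ L) (hr : IsStripTwist (stripRev f) κ L)
    (hC : IsEssInvariant f C) {p : Strip} : f p ∈ belowSet C ↔ p ∈ belowSet C := by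
  refine ⟨fun hp => ?_, image_belowSet_subset hf hr hC⟩
  have := image_belowSet_subset hr (by rwa [stripRev_stripRev]) hC.rev (p := stripRefl (f p))
    (by simpa [belowSet, stripRefl_apply] using hp)
  simpa [stripRev, belowSet, stripRefl_apply] using this

/-- The lower boundary of `C`. -/
def lowerBoundary (C : Set Strip) : Set Strip := {p | p ∈ C ∧ ∀ y < p.2, (p.1, y) ∉ C}

lemma image_mem_lowerBoundary (hf : IsStripTwist f κ L) (hr : IsStripTwist (stripRev f) κ L)
    (hC : IsEssInvariant f C) {p : Strip} (hp : p ∈ lowerBoundary C) :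
    f p ∈ lowerBoundary C := by
  obtain ⟨hpC, hpV⟩ := hp
  refine ⟨(hC.inv p).2 hpC, fun y hy hyC => ?_⟩
  obtain ⟨y₁, hy₁, hy₁'⟩ := exists_between hy
  obtain ⟨y₂, hy₂, hy₂'⟩ := exists_between hy₁'
  have hp0 : 0 < p.2 := by
    refine lt_of_le_of_ne unitInterval.nonneg' fun h => ?_
    have h1 := hf.bottom p.1
    rw [show (p.1, (0 : unitInterval)) = p by rw [h]] at h1
    rw [h1] at hy
    exact unitInterval.nonneg'.not_gt hy
  have hbelow : ∀ u < p.2, (p.1, u) ∈ belowSet C := fun u hu z hz => hpV z (hz.trans_lt hu)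
  have hev : ∀ᶠ u in 𝓝 p.2, y₂ < (f (p.1, u)).2 :=
    (isOpen_lt continuous_const (by fun_prop)).mem_nhds hy₂'
  obtain ⟨u₀, hu₀, hu₀'⟩ := exists_Ioc_subset_of_mem_nhds hev ⟨0, hp0⟩
  obtain ⟨u₁, hu₁, hu₁'⟩ := exists_between hu₀
  -- a rectangle to the left of the point `(x, y₁)`, where `f p` lies over `x`
  have hrect : ∀ q : Strip, (f (p.1, u₁)).1 < q.1 → q.1 < (f p).1 → q.2 < y₂ →
      q ∈ belowSet C := by
    intro q h1 h2 h3
    obtain ⟨u, hu, huq⟩ := intermediate_value_Icc hu₁'.le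
      (f := fun u => (f (p.1, u)).1) (by fun_prop) ⟨h1.le, h2.le⟩
    have hup : u < p.2 := hu.2.lt_of_ne (by rintro rfl; exact h2.ne' huq)
    have hV := image_belowSet_subset hf hr hC (hbelow u hup)
    have := hu₀' ⟨hu₁.trans_le hu.1, hu.2⟩
    simp only at huq
    rw [← Prod.mk.eta (p := f (p.1, u)), huq] at hV
    exact belowSet_of_snd_le hV (h3.trans this).le
  set q : Strip := ((f p).1, y₁)
  have hq1 : (f q).2 < 1 :=
    hr.snd_lt_one_of_rev (hy₁'.trans_le unitInterval.le_one')
  have hWopen : ∀ᶠ w in 𝓝 (f q).2, (f (p.1, u₁)).1 < (f.symm ((f q).1, w)).1 ∧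
      (f.symm ((f q).1, w)).2 < y₂ := by
    have hc : Continuous fun w => f.symm ((f q).1, w) := by fun_prop
    refine (hc.fst.continuousAt.eventually_const_lt ?_).and
      (hc.snd.continuousAt.eventually_lt_const ?_)
    · simpa [q] using hf.strictMono p.1 hu₁'
    · simpa [q] using hy₂
  obtain ⟨w₀, hw₀, hw₀'⟩ := exists_Ico_subset_of_mem_nhds hWopen ⟨1, hq1⟩
  obtain ⟨w, hw, hw'⟩ := exists_between hw₀
  have hwV := hrect (f.symm ((f q).1, w)) (hw₀' ⟨hw.le, hw'⟩).1
    (by simpa [q] using hr.symm_strictAnti (f q).1 hw) (hw₀' ⟨hw.le, hw'⟩).2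
  have := image_belowSet_subset hf hr hC hwV
  rw [Homeomorph.apply_symm_apply] at this
  have hqV := (mem_belowSet_iff hf hr hC).1
    (belowSet_of_snd_le this hw.le : f q ∈ belowSet C)
  exact hqV y hy₁.le hyC

lemma IsStripTwist.bottom_strictMono (hf : IsStripTwist f κ L) :
    StrictMono fun x => (f (x, 0)).1 := by
  have hinj : Function.Injective fun x => (f (x, 0)).1 := fun x₁ x₂ h => by
    have := f.injective (Prod.ext h ((hf.bottom x₁).trans (hf.bottom x₂).symm))
    exact congrArg Prod.fst this
  refine ((by fun_prop : Continuous _).strictMono_of_inj hinj).resolve_right fun h => ?_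
  have h1 := h (zero_lt_one' ℝ)
  have h2 := hf.lift (0, 0)
  simp only [zero_add] at h1 h2
  rw [h2] at h1
  simp only at h1
  linarith

lemma fst_lt_of_mem_lowerBoundary (hf : IsStripTwist f κ L)
    (hr : IsStripTwist (stripRev f) κ L) (hC : IsEssInvariant f C) {p q : Strip}
    (hp : p ∈ lowerBoundary C) (hq : q ∈ lowerBoundary C) (hpq : p.1 < q.1) :
    (f p).1 < (f q).1 := by
  by_contra! hcon
  have hbase : (f (p.1, 0)).1 < (f (q.1, 0)).1 := hf.bottom_strictMono hpq
  obtain ⟨u, hu, huq⟩ := intermediate_value_Icc (unitInterval.nonneg' (t := p.2))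
    (f := fun u => (f (p.1, u)).1) (by fun_prop)
    ⟨hbase.le.trans ((hf.strictMono q.1).monotone unitInterval.nonneg'), hcon⟩
  have hle : (f (p.1, u)).2 ≤ (f q).2 := by
    by_contra! h
    simp only at huq
    rcases hu.2.lt_or_eq with hup | rfl
    · have := image_belowSet_subset hf hr hC
        (show (p.1, u) ∈ belowSet C from fun z hz => hp.2 z (hz.trans_lt hup))
      have := this _ h.le
      rw [huq, Prod.mk.eta, hC.inv] at this
      exact this hq.1
    · refine (image_mem_lowerBoundary hf hr hC hp).2 _ h ?_
      rw [Prod.mk.eta] at huq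
      simpa [huq, hC.inv] using hq.1
  have := (hr.symm_strictAnti (f q).1).antitone hle
  simp only at huq this
  nth_rewrite 2 [← huq] at this
  simp only [Prod.mk.eta, Homeomorph.symm_apply_apply] at this
  linarith

lemma mul_sub_le_of_mem_lowerBoundary (hf : IsStripTwist f κ L)
    (hr : IsStripTwist (stripRev f) κ L) (hC : IsEssInvariant f C) {p q : Strip}
    (hp : p ∈ lowerBoundary C) (hq : q ∈ lowerBoundary C) (hpq : p.1 < q.1)
    (hpq' : |p.1 - q.1| ≤ 1) : κ * (p.2 - q.2 : ℝ) ≤ L * |p.1 - q.1| := by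
  have hlip := hf.lip p.1 q.1 q.2 hpq'
  rcases le_total p.2 q.2 with h | h
  · have h1 : (p.2 - q.2 : ℝ) ≤ 0 := sub_nonpos.2 h
    exact (mul_nonpos_of_nonneg_of_nonpos hf.pos.le h1).trans ((abs_nonneg _).trans hlip)
  · have h1 := hf.twist p.1 q.2 p.2 h
    have h2 := fst_lt_of_mem_lowerBoundary hf hr hC hp hq hpq
    simp only [Prod.mk.eta] at h1 hlip
    linarith [neg_le_abs ((f (p.1, q.2)).1 - (f q).1)]

/-- The lower boundary of an essential invariant set is a Lipschitz graph. -/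
theorem abs_sub_le_of_mem_lowerBoundary (hf : IsStripTwist f κ L)
    (hr : IsStripTwist (stripRev f) κ L) (hC : IsEssInvariant f C) {p q : Strip}
    (hp : p ∈ lowerBoundary C) (hq : q ∈ lowerBoundary C) (hpq : p.1 < q.1)
    (hpq' : |p.1 - q.1| ≤ 1) : |(p.2 - q.2 : ℝ)| ≤ L / κ * |p.1 - q.1| := by
  have h1 := mul_sub_le_of_mem_lowerBoundary hf hr hC hp hq hpq hpq'
  have hrefl : ∀ p ∈ lowerBoundary C, stripRefl p ∈ lowerBoundary (stripRefl ⁻¹' C) :=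
    fun p hp => ⟨by simpa using hp.1, fun y hy => by
      simpa [stripRefl_apply] using hp.2 y hy⟩
  have h2 := mul_sub_le_of_mem_lowerBoundary hr (by rwa [stripRev_stripRev]) hC.rev
    (hrefl q hq) (hrefl p hp) (by simpa [stripRefl_apply] using hpq)
    (by simpa [stripRefl_apply, neg_add_eq_sub] using hpq')
  simp only [stripRefl_apply, neg_sub_neg] at h2
  rw [div_mul_eq_mul_div, le_div_iff₀ hf.pos]
  rcases abs_cases (p.2 - q.2 : ℝ) with ⟨h, -⟩ | ⟨h, -⟩ <;> rw [h] <;> linarith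

end Graph

section Calculus

lemma ann_eq_prod : Ann = univ ×ˢ Icc (0 : ℝ) 1 := by
  ext p
  simp [Ann]

lemma uniqueDiffOn_ann : UniqueDiffOn ℝ Ann := by
  rw [ann_eq_prod]
  exact uniqueDiffOn_univ.prod (uniqueDiffOn_Icc one_pos)

/-- The restriction of a differentiable function on the strip to a vertical segment. -/
lemma hasDerivWithinAt_vertical {E : Type*} [NormedAddCommGroup E] [NormedSpace ℝ E]
    {φ : ℝ × ℝ → E} (hφ : DifferentiableOn ℝ φ Ann) {x y : ℝ} (hy : y ∈ Icc (0 : ℝ) 1) :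
    HasDerivWithinAt (fun t => φ (x, t)) (fderivWithin ℝ φ Ann (x, y) (0, 1))
      (Icc 0 1) y := by
  have h1 := (hφ (x, y) hy).hasFDerivWithinAt
  have h2 : HasDerivWithinAt (fun t : ℝ => (x, t)) ((0 : ℝ), (1 : ℝ)) (Icc 0 1) y :=
    (hasDerivWithinAt_const y _ x).prodMk (hasDerivWithinAt_id y _)
  exact h1.comp_hasDerivWithinAt y h2 fun t ht => ht

/-- A `C¹` function on the strip, periodic up to a constant and with positive vertical
derivative, has uniform vertical expansion. -/
lemma exists_uniform_twist {φ : ℝ × ℝ → ℝ} {c : ℝ} (hφ : ContDiffOn ℝ 1 φ Ann)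
    (hper : ∀ p ∈ Ann, φ (p.1 + 1, p.2) = φ p + c)
    (hpos : ∀ p ∈ Ann, 0 < fderivWithin ℝ φ Ann p (0, 1)) :
    ∃ κ > 0, ∀ x, ∀ y₁ ∈ Icc (0 : ℝ) 1, ∀ y₂ ∈ Icc (0 : ℝ) 1, y₁ ≤ y₂ →
      κ * (y₂ - y₁) ≤ φ (x, y₂) - φ (x, y₁) := by
  have hdiff := hφ.differentiableOn one_ne_zero
  have hsub : Icc (0 : ℝ) 1 ×ˢ Icc (0 : ℝ) 1 ⊆ Ann := fun p hp => hp.2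
  have hcont : ContinuousOn (fun p => fderivWithin ℝ φ Ann p (0, 1))
      (Icc (0 : ℝ) 1 ×ˢ Icc (0 : ℝ) 1) :=
    ((hφ.continuousOn_fderivWithin uniqueDiffOn_ann le_rfl).mono hsub).clm_apply
      continuousOn_const
  obtain ⟨p, hp, hmin⟩ := (isCompact_Icc.prod isCompact_Icc).exists_isMinOn
    ⟨(0, 0), by simp⟩ hcont
  refine ⟨_, hpos p (hsub hp), fun x y₁ h₁ y₂ h₂ h => ?_⟩
  have hP : Function.Periodic (fun x => φ (x, y₂) - φ (x, y₁)) 1 := fun x => by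
    have e1 := hper (x, y₁) h₁
    have e2 := hper (x, y₂) h₂
    simp only at e1 e2
    simp only [e1, e2]
    ring
  obtain ⟨x', hx', he⟩ := hP.exists_mem_Ico₀ one_pos x
  rw [he]
  have hd : ∀ y ∈ Icc (0 : ℝ) 1, HasDerivWithinAt (fun t => φ (x', t))
      (fderivWithin ℝ φ Ann (x', y) (0, 1)) (Icc 0 1) y :=
    fun y hy => hasDerivWithinAt_vertical hdiff hy
  have hI : interior (Icc (0 : ℝ) 1) ⊆ Icc 0 1 := interior_subset
  have hd' : ∀ y ∈ interior (Icc (0 : ℝ) 1), HasDerivAt (fun t => φ (x', t))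
      (fderivWithin ℝ φ Ann (x', y) (0, 1)) y := fun y hy =>
    (hd y (hI hy)).hasDerivAt (mem_interior_iff_mem_nhds.1 hy)
  refine (convex_Icc (0 : ℝ) 1).mul_sub_le_image_sub_of_le_deriv
    (fun y hy => (hd y hy).continuousWithinAt)
    (fun y hy => (hd' y hy).differentiableAt.differentiableWithinAt) (fun y hy => ?_)
    _ h₁ _ h₂ h
  rw [(hd' y hy).deriv]
  exact hmin (show (x', y) ∈ Icc (0 : ℝ) 1 ×ˢ Icc (0 : ℝ) 1 from
    ⟨Ico_subset_Icc_self hx', hI hy⟩)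

lemma exists_horizontal_lipschitz {φ : ℝ × ℝ → ℝ} {c : ℝ} (hφ : ContDiffOn ℝ 1 φ Ann)
    (hper : ∀ p ∈ Ann, φ (p.1 + 1, p.2) = φ p + c) :
    ∃ L, ∀ x₁ x₂, ∀ y ∈ Icc (0 : ℝ) 1, |x₁ - x₂| ≤ 1 →
      |φ (x₁, y) - φ (x₂, y)| ≤ L * |x₁ - x₂| := by
  have hsub : Icc (-1 : ℝ) 2 ×ˢ Icc (0 : ℝ) 1 ⊆ Ann := fun p hp => hp.2
  obtain ⟨K, hK⟩ := (hφ.mono hsub).exists_lipschitzOnWith one_ne_zero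
    ((convex_Icc _ _).prod (convex_Icc _ _)) (isCompact_Icc.prod isCompact_Icc)
  refine ⟨K, fun x₁ x₂ y hy h => ?_⟩
  have hP : Function.Periodic (fun x => φ (x, y) - φ (x + (x₂ - x₁), y)) 1 := fun x => by
    have e1 := hper (x, y) hy
    have e2 := hper (x + (x₂ - x₁), y) hy
    simp only at e1 e2
    simp only [add_right_comm x 1, e1, e2]
    ring
  obtain ⟨x, hx, he⟩ := hP.exists_mem_Ico₀ one_pos x₁
  simp only [add_sub_cancel] at he
  rw [he]
  rw [abs_le] at h
  have := hK.dist_le_mul (x, y) ⟨⟨by linarith [hx.1], by linarith [hx.2]⟩, hy⟩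
    (x + (x₂ - x₁), y) ⟨⟨by dsimp only; linarith [hx.1], by dsimp only; linarith [hx.2]⟩, hy⟩
  simpa [Real.dist_eq, Prod.dist_eq, abs_sub_comm x₂ x₁] using this

lemma linearMap_det_prod (T : ℝ × ℝ →ₗ[ℝ] ℝ × ℝ) :
    LinearMap.det T = (T (1, 0)).1 * (T (0, 1)).2 - (T (0, 1)).1 * (T (1, 0)).2 := by
  rw [← LinearMap.det_toMatrix (Module.Basis.finTwoProd ℝ), Matrix.det_fin_two]
  simp [LinearMap.toMatrix_apply]

/-- A right inverse of an orientation-preserving linear map tilting the vertical direction to the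
right tilts it to the left. -/
lemma fst_neg_of_comp_eq_id {T S : ℝ × ℝ →ₗ[ℝ] ℝ × ℝ} (hTS : ∀ v, T (S v) = v)
    (hdet : 0 < LinearMap.det T) (htw : 0 < (T (0, 1)).1) : (S (0, 1)).1 < 0 := by
  rw [linearMap_det_prod] at hdet
  set v := S (0, 1) with hv
  have h := hTS (0, 1)
  rw [← hv, show v = v.1 • ((1 : ℝ), (0 : ℝ)) + v.2 • ((0 : ℝ), (1 : ℝ)) by ext <;> simp,
    map_add, map_smul, map_smul, Prod.ext_iff] at h
  simp only [Prod.fst_add, Prod.snd_add, Prod.smul_fst, Prod.smul_snd, smul_eq_mul] at h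
  by_contra! hcon
  have h1 := mul_nonneg hcon hdet.le
  have h2 : v.1 * ((T (1, 0)).1 * (T (0, 1)).2 - (T (0, 1)).1 * (T (1, 0)).2) =
      -(T (0, 1)).1 := by
    linear_combination (T (0, 1)).2 * h.1 - (T (0, 1)).1 * h.2
  linarith

end Calculus

namespace AnnulusTwistMap

variable (F : AnnulusTwistMap)

/-- The inclusion of the strip in the plane. -/
def incl (p : Strip) : ℝ × ℝ := (p.1, p.2)

lemma incl_mem (p : Strip) : incl p ∈ Ann := p.2.2

lemma continuous_incl : Continuous incl := by unfold incl; fun_prop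

lemma measurableEmbedding_incl : MeasurableEmbedding incl :=
  MeasurableEmbedding.id.prodMap (MeasurableEmbedding.subtype_coe measurableSet_Icc)

lemma volume_eq_volume_image_incl (s : Set Strip) : volume s = volume (incl '' s) := by
  have h : MeasurePreserving incl volume ((volume : Measure ℝ).prod
      ((volume : Measure ℝ).restrict unitInterval)) :=
    (MeasurePreserving.id volume).prod unitInterval.measurePreserving_coe
  rw [← preimage_image_eq s measurableEmbedding_incl.injective,
    h.measure_preimage_emb measurableEmbedding_incl,
    preimage_image_eq s measurableEmbedding_incl.injective]
  have h2 : (volume : Measure ℝ).prod ((volume : Measure ℝ).restrict unitInterval) =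
      (volume : Measure (ℝ × ℝ)).restrict Ann := by
    rw [ann_eq_prod, Measure.volume_eq_prod, ← Measure.prod_restrict, Measure.restrict_univ]
  rw [h2, Measure.restrict_eq_self]
  rintro _ ⟨p, -, rfl⟩
  exact incl_mem p

/-- A twist map as a homeomorphism of the strip. -/
def toHomeo : Strip ≃ₜ Strip where
  toFun p := ((F.f (incl p)).1, ⟨(F.f (incl p)).2, F.maps (incl_mem p)⟩)
  invFun p := ((F.finv (incl p)).1, ⟨(F.finv (incl p)).2, F.maps_inv (incl_mem p)⟩)
  left_inv p := measurableEmbedding_incl.injective (F.left_inv _ (incl_mem p))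
  right_inv p := measurableEmbedding_incl.injective (F.right_inv _ (incl_mem p))
  continuous_toFun := by
    have := F.smooth.continuousOn.comp_continuous continuous_incl incl_mem
    exact this.fst.prodMk (this.snd.subtype_mk _)
  continuous_invFun := by
    have := F.smooth_inv.continuousOn.comp_continuous continuous_incl incl_mem
    exact this.fst.prodMk (this.snd.subtype_mk _)

lemma incl_toHomeo (p : Strip) : incl (F.toHomeo p) = F.f (incl p) := rfl

lemma incl_injective : Function.Injective incl := measurableEmbedding_incl.injective

lemma toHomeo_lift (p : Strip) :
    F.toHomeo (p.1 + 1, p.2) = ((F.toHomeo p).1 + 1, (F.toHomeo p).2) := by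
  apply incl_injective
  have := F.lift _ (incl_mem p)
  rw [incl_toHomeo]
  refine Eq.trans this (Prod.ext rfl ?_)
  exact add_zero _

lemma toHomeo_lift_int (x : ℝ) (y : unitInterval) (n : ℤ) :
    F.toHomeo (x + n, y) = ((F.toHomeo (x, y)).1 + n, (F.toHomeo (x, y)).2) := by
  have hP : Function.Periodic
      (fun x => ((F.toHomeo (x, y)).1 - x, (F.toHomeo (x, y)).2)) 1 := fun x => by
    have := F.toHomeo_lift (x, y)
    simp only at this
    simp [this]
  obtain ⟨h1, h2⟩ := Prod.ext_iff.1 (hP.int_mul n x)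
  simp only [mul_one] at h1 h2
  exact Prod.ext (by linarith) h2

lemma toHomeo_symm_lift (p : Strip) :
    F.toHomeo.symm (p.1 + 1, p.2) = ((F.toHomeo.symm p).1 + 1, (F.toHomeo.symm p).2) := by
  rw [Homeomorph.symm_apply_eq, toHomeo_lift]
  simp

lemma toHomeo_bottom (x : ℝ) : (F.toHomeo (x, 0)).2 = 0 := Subtype.ext (F.bottom x)

lemma toHomeo_top (x : ℝ) : (F.toHomeo (x, 1)).2 = 1 := Subtype.ext (F.top x)

lemma toHomeo_area : MeasurePreserving F.toHomeo volume volume := by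
  refine ⟨F.toHomeo.continuous.measurable, Measure.ext fun s hs => ?_⟩
  have hm := F.toHomeo.continuous.measurable hs
  rw [Measure.map_apply F.toHomeo.continuous.measurable hs, volume_eq_volume_image_incl,
    ← F.area _ (by rintro _ ⟨p, -, rfl⟩; exact incl_mem p)
      (measurableEmbedding_incl.measurableSet_image.2 hm),
    volume_eq_volume_image_incl s]
  congr 1
  rw [image_image]
  simp only [← incl_toHomeo]
  rw [← image_image, image_preimage_eq _ F.toHomeo.surjective]

/-- Every abscissa is attained on the image of a horizontal line. -/
lemma exists_toHomeo_fst_eq (y : unitInterval) (x : ℝ) :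
    ∃ x', (F.toHomeo (x', y)).1 = x := by
  have key (n : ℤ) : (F.toHomeo (n, y)).1 = (F.toHomeo (0, y)).1 + n := by
    simpa using congrArg Prod.fst (F.toHomeo_lift_int 0 y n)
  set a := (F.toHomeo (0, y)).1
  have h1 : (F.toHomeo (((⌊x - a⌋ : ℤ) : ℝ), y)).1 ≤ x := by
    rw [key]; linarith [Int.floor_le (x - a)]
  have h2 : x ≤ (F.toHomeo (((⌈x - a⌉ : ℤ) : ℝ), y)).1 := by
    rw [key]; linarith [Int.le_ceil (x - a)]
  exact mem_range_of_exists_le_of_exists_ge (F.toHomeo.continuous.comp (.prodMk_left y)).fst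
    ⟨_, h1⟩ ⟨_, h2⟩

lemma toHomeo_symm_boundary {y : unitInterval} (hy : ∀ x, (F.toHomeo (x, y)).2 = y) (x : ℝ) :
    (F.toHomeo.symm (x, y)).2 = y := by
  obtain ⟨x', hx'⟩ := F.exists_toHomeo_fst_eq y x
  have : F.toHomeo (x', y) = (x, y) := Prod.ext hx' (hy x')
  rw [← this, Homeomorph.symm_apply_apply]

lemma fderivWithin_vertical_pos {p : ℝ × ℝ} (hp : p ∈ Ann) :
    0 < (fderivWithin ℝ F.f Ann p (0, 1)).1 := by
  have h1 := (hasDerivWithinAt_vertical (F.smooth.differentiableOn one_ne_zero)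
    (x := p.1) hp)
  have h2 : HasDerivWithinAt (fun t => (F.f (p.1, t)).1)
      (fderivWithin ℝ F.f Ann p (0, 1)).1 (Icc 0 1) p.2 :=
    (ContinuousLinearMap.fst ℝ ℝ ℝ).hasFDerivAt.comp_hasDerivWithinAt _ h1
  have h3 := F.twist p hp
  rwa [h2.derivWithin (uniqueDiffOn_Icc one_pos _ hp)] at h3

lemma fderivWithin_finv_vertical_neg {p : ℝ × ℝ} (hp : p ∈ Ann) :
    (fderivWithin ℝ F.finv Ann p (0, 1)).1 < 0 := by
  have hq := F.maps_inv hp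
  have h1 := (F.smooth.differentiableOn one_ne_zero _ hq).hasFDerivWithinAt
  have h2 := (F.smooth_inv.differentiableOn one_ne_zero _ hp).hasFDerivWithinAt
  have h3 := (h1.comp p h2 F.maps_inv).congr (f₁ := id)
    (fun q hq => (F.right_inv q hq).symm) (F.right_inv p hp).symm
  have h4 := (uniqueDiffOn_ann p hp).eq h3 (hasFDerivWithinAt_id p Ann)
  refine fst_neg_of_comp_eq_id (T := (fderivWithin ℝ F.f Ann (F.finv p)).toLinearMap)
    (S := (fderivWithin ℝ F.finv Ann p).toLinearMap) (fun v => ?_) (F.orient _ hq)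
    (F.fderivWithin_vertical_pos hq)
  exact congrArg (fun T : ℝ × ℝ →L[ℝ] ℝ × ℝ => T v) h4

lemma exists_isStripTwist : ∃ κ L, IsStripTwist F.toHomeo κ L ∧
    IsStripTwist (stripRev F.toHomeo) κ L := by
  have hfst {φ : ℝ × ℝ → ℝ × ℝ} (hφ : ContDiffOn ℝ 1 φ Ann) {p : ℝ × ℝ} (hp : p ∈ Ann)
      (v : ℝ × ℝ) :
      fderivWithin ℝ (fun p => (φ p).1) Ann p v = (fderivWithin ℝ φ Ann p v).1 := by
    have h := (hφ.differentiableOn one_ne_zero p hp).hasFDerivWithinAt.fst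
    rw [h.fderivWithin (uniqueDiffOn_ann p hp)]
    rfl
  have hs := F.smooth.fst
  have hs' := F.smooth_inv.fst
  have hper : ∀ p ∈ Ann, (F.f (p.1 + 1, p.2)).1 = (F.f p).1 + 1 := fun p hp => by
    rw [F.lift p hp]; rfl
  have hper' : ∀ p ∈ Ann, (F.finv (p.1 + 1, p.2)).1 = (F.finv p).1 + 1 := fun p hp =>
    congrArg Prod.fst (F.toHomeo_symm_lift (p.1, ⟨p.2, hp⟩))
  obtain ⟨κ, hκ, htw⟩ := exists_uniform_twist hs hper fun p hp => by
    rw [hfst F.smooth hp]; exact F.fderivWithin_vertical_pos hp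
  obtain ⟨κ', hκ', htw'⟩ := exists_uniform_twist (c := -1) hs'.neg
    (fun p hp => by rw [hper' p hp]; ring) fun p hp => by
      rw [fderivWithin_fun_neg (uniqueDiffOn_ann p hp)]
      simpa [hfst F.smooth_inv hp] using F.fderivWithin_finv_vertical_neg hp
  obtain ⟨L, hL⟩ := exists_horizontal_lipschitz hs hper
  obtain ⟨L', hL'⟩ := exists_horizontal_lipschitz hs' hper'
  refine ⟨min κ κ', max L L', ⟨lt_min hκ hκ', F.toHomeo_lift, F.toHomeo_bottom, F.toHomeo_top,
    F.toHomeo_area, fun x y₁ y₂ h => ?_, fun x₁ x₂ y h => ?_⟩,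
    ⟨lt_min hκ hκ', fun p => ?_, fun x => ?_, fun x => ?_, ?_, fun x y₁ y₂ h => ?_,
      fun x₁ x₂ y h => ?_⟩⟩
  · refine le_trans ?_ (htw x y₁ y₁.2 y₂ y₂.2 h)
    exact mul_le_mul_of_nonneg_right (min_le_left _ _) (sub_nonneg.2 h)
  · refine (hL x₁ x₂ y y.2 h).trans ?_
    gcongr
    exact le_max_left _ _
  · have := F.toHomeo_symm_lift (-(p.1 + 1), p.2)
    simp only [neg_add_rev, neg_add_cancel_comm] at this
    simp only [stripRev_apply, this, neg_add_rev]
    ring_nf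
  · exact F.toHomeo_symm_boundary F.toHomeo_bottom _
  · exact F.toHomeo_symm_boundary F.toHomeo_top _
  · have hrefl : MeasurePreserving stripRefl volume volume :=
      (Measure.measurePreserving_neg volume).prod (MeasurePreserving.id volume)
    exact hrefl.comp ((MeasurePreserving.symm F.toHomeo.toMeasurableEquiv F.toHomeo_area).comp
      hrefl)
  · refine le_trans ?_ ((htw' (-x) y₁ y₁.2 y₂ y₂.2 h).trans_eq ?_)
    · exact mul_le_mul_of_nonneg_right (min_le_right _ _) (sub_nonneg.2 h)
    · rfl
  · have := hL' (-x₁) (-x₂) y y.2 (by rwa [neg_sub_neg, abs_sub_comm])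
    rw [neg_sub_neg, abs_sub_comm x₂] at this
    refine le_trans (le_of_eq ?_) (this.trans ?_)
    · rw [stripRev_apply, stripRev_apply, neg_sub_neg, abs_sub_comm]
      rfl
    · gcongr
      exact le_max_right _ _

end AnnulusTwistMap

end Preliminaries

section Circle

/-- A circle map of degree `0` lifts to the line, and a circle map of nonzero degree has a
surjective lift between universal covers. -/
lemma circle_map_lift (g : C(Circle1, Circle1)) :
    (∃ ψ : C(Circle1, ℝ), ∀ x, (ψ x : Circle1) = g x) ∨
      ∃ X : C(ℝ, ℝ), Function.Surjective X ∧ ∀ t : ℝ, (X t : Circle1) = g t := by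
  obtain ⟨a, ha⟩ := QuotientAddGroup.mk_surjective (g ((0 : ℝ) : Circle1))
  obtain ⟨X, ⟨-, hX⟩, -⟩ := (AddCircle.isCoveringMap_coe (1 : ℝ)).existsUnique_continuousMap_lifts
    (g.comp ⟨((↑) : ℝ → Circle1), AddCircle.continuous_mk' 1⟩) 0 a ha
  replace hX (t : ℝ) : (X t : Circle1) = g t := congrFun hX t
  have hint (t : ℝ) : ∃ n : ℤ, (n : ℝ) = X (t + 1) - X t := by
    have h : ((X (t + 1) - X t : ℝ) : Circle1) = 0 := by
      rw [AddCircle.coe_sub, hX, hX, AddCircle.coe_add_period, sub_self]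
    obtain ⟨n, hn⟩ := (AddCircle.coe_eq_zero_iff (1 : ℝ)).1 h
    exact ⟨n, by simpa using hn⟩
  choose N hN using hint
  have hNc : Continuous N := by
    rw [Int.isClosedEmbedding_coe_real.isInducing.continuous_iff]
    have : ((↑) : ℤ → ℝ) ∘ N = fun t => X (t + 1) - X t := funext hN
    rw [this]
    fun_prop
  have hd (t : ℝ) : X (t + 1) = X t + N 0 := by
    have := PreconnectedSpace.constant inferInstance hNc (x := t) (y := 0)
    rw [← this, hN]
    ring
  rcases eq_or_ne (N 0) 0 with h0 | h0
  · have hper : Function.Periodic X 1 := fun t => by simp [hd t, h0]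
    refine .inl ⟨⟨hper.lift, continuous_quot_lift _ X.continuous⟩, fun x => ?_⟩
    induction x using QuotientAddGroup.induction_on with
    | H t => exact hX t
  · refine .inr ⟨X, ?_, hX⟩
    have key (n : ℤ) : X n = X 0 + n * N 0 := by
      have hP : Function.Periodic (fun t => X t - t * N 0) 1 := fun t => by
        simp only [hd t]; ring
      have := hP.int_mul n 0
      simp only [mul_one, zero_add, zero_mul, sub_zero] at this
      linarith
    intro y
    have hN0 : (1 : ℝ) ≤ N 0 * N 0 := by
      exact_mod_cast (mul_self_pos.2 h0 : 0 < N 0 * N 0)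
    set k := ⌈|y - X 0|⌉
    have hk : |y - X 0| ≤ k := Int.le_ceil _
    have hk' : (k : ℝ) ≤ k * (N 0 * N 0) :=
      le_mul_of_one_le_right ((abs_nonneg _).trans hk) hN0
    rw [abs_le] at hk
    refine mem_range_of_exists_le_of_exists_ge X.continuous
      ⟨((-(k * N 0) : ℤ) : ℝ), ?_⟩ ⟨((k * N 0 : ℤ) : ℝ), ?_⟩
    all_goals
      rw [key]
      push_cast
      linarith

/-- Every continuous real function on the circle takes equal values at two antipodal points. -/
lemma not_injective_of_continuous_circle {ψ : Circle1 → ℝ} (hψ : Continuous ψ) :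
    ¬ Function.Injective ψ := by
  intro hinj
  set h : ℝ → ℝ := fun t => ψ ((t + 1 / 2 : ℝ)) - ψ t with hh
  have hc : Continuous h := by
    have := AddCircle.continuous_mk' (1 : ℝ)
    exact (hψ.comp (this.comp (by fun_prop))).sub (hψ.comp this)
  have hneg : h (1 / 2) = -h 0 := by
    have : (((1 / 2 + 1 / 2 : ℝ)) : Circle1) = ((0 : ℝ) : Circle1) := by
      norm_num
    simp only [hh, this, zero_add]
    ring
  obtain ⟨t, ht⟩ : ∃ t, h t = 0 := by
    rcases le_total (h 0) 0 with h0 | h0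
    · exact mem_range_of_exists_le_of_exists_ge hc ⟨0, h0⟩ ⟨1 / 2, by linarith⟩
    · exact mem_range_of_exists_le_of_exists_ge hc ⟨1 / 2, by linarith⟩ ⟨0, h0⟩
  have := hinj (sub_eq_zero.1 ht)
  rw [AddCircle.coe_add, add_eq_left, AddCircle.coe_eq_zero_iff] at this
  obtain ⟨n, hn⟩ := this
  have h2 : ((2 * n : ℤ) : ℝ) = (1 : ℤ) := by
    push_cast
    simp only [zsmul_eq_mul, mul_one] at hn
    linarith
  have := Int.cast_injective h2
  omega

lemma surjective_of_injective_circle {g : Circle1 → Circle1} (hg : Continuous g)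
    (hinj : Function.Injective g) : Function.Surjective g := by
  rcases circle_map_lift ⟨g, hg⟩ with ⟨ψ, hψ⟩ | ⟨X, hX, hXg⟩
  · refine absurd (fun x y hxy => hinj ?_) (not_injective_of_continuous_circle ψ.continuous)
    have := hψ x
    rw [hxy, hψ] at this
    exact this.symm
  · intro y
    induction y using QuotientAddGroup.induction_on with
    | H t =>
      obtain ⟨s, rfl⟩ := hX t
      exact ⟨s, (hXg s).symm⟩

/-- A loop in the annulus whose angular part lifts to the line is null-homotopic. -/
lemma homotopic_const_of_lift {γ : C(Circle1, AnnQ)} {ψ : C(Circle1, ℝ)}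
    (hψ : ∀ x, (ψ x : Circle1) = (γ x).1.1) :
    ∃ c, ContinuousMap.Homotopic γ (ContinuousMap.const Circle1 c) := by
  have hmem (s : unitInterval) (x : Circle1) :
      ((((1 - s) * ψ x : ℝ) : Circle1), (1 - s) * (γ x).1.2) ∈ AnnQ := by
    have h := (γ x).2
    exact ⟨mul_nonneg (sub_nonneg.2 s.2.2) h.1,
      mul_le_one₀ (sub_le_self _ s.2.1) h.1 h.2⟩
  refine ⟨⟨(((0 : ℝ) : Circle1), 0), by simp [AnnQ]⟩,
    ⟨⟨⟨fun p => ⟨_, hmem p.1 p.2⟩, ?_⟩, fun x => ?_, fun x => ?_⟩⟩⟩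
  · refine Continuous.subtype_mk (.prodMk ((AddCircle.continuous_mk' 1).comp ?_) ?_) _ <;> fun_prop
  · apply Subtype.ext
    simp [hψ]
  · apply Subtype.ext
    simp

end Circle

section Quotient

/-- The lift to the strip of a subset of the quotient annulus. -/
def annulusLift (C : Set (Circle1 × ℝ)) : Set Strip :=
  {p | ((p.1 : Circle1), (p.2 : ℝ)) ∈ C}

lemma mem_annulusLift {C : Set (Circle1 × ℝ)} {p : Strip} :
    p ∈ annulusLift C ↔ ((p.1 : Circle1), (p.2 : ℝ)) ∈ C := Iff.rfl

lemma periodic_annulusLift (C : Set (Circle1 × ℝ)) (p : Strip) :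
    (p.1 + 1, p.2) ∈ annulusLift C ↔ p ∈ annulusLift C := by
  simp only [mem_annulusLift, AddCircle.coe_add_period]

lemma AnnulusTwistMap.toHomeo_mem_annulusLift (F : AnnulusTwistMap)
    {Fq : Circle1 × ℝ → Circle1 × ℝ} {C : Set (Circle1 × ℝ)}
    (hFq : ∀ p : ℝ × ℝ, Fq ((p.1 : Circle1), p.2) = (((F.f p).1 : Circle1), (F.f p).2))
    (hCA : C ⊆ AnnQ) (hCinv : Fq '' C = C) (p : Strip) :
    F.toHomeo p ∈ annulusLift C ↔ p ∈ annulusLift C := by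
  have hF (q : Strip) : Fq ((q.1 : Circle1), (q.2 : ℝ)) =
      (((F.toHomeo q).1 : Circle1), ((F.toHomeo q).2 : ℝ)) := hFq (incl q)
  refine ⟨fun h => ?_, fun h => ?_⟩
  · rw [mem_annulusLift, ← hCinv] at h
    obtain ⟨⟨x, y⟩, hc, he⟩ := h
    obtain ⟨x, rfl⟩ := QuotientAddGroup.mk_surjective x
    obtain ⟨h1, h2⟩ := Prod.ext_iff.1 ((hF (x, ⟨y, hCA hc⟩)).symm.trans he)
    have h3 : (((F.toHomeo p).1 - (F.toHomeo (x, ⟨y, hCA hc⟩)).1 : ℝ) : Circle1) = 0 := by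
      rw [AddCircle.coe_sub, sub_eq_zero]
      exact h1.symm
    obtain ⟨n, hn⟩ := (AddCircle.coe_eq_zero_iff (1 : ℝ)).1 h3
    have hlift : F.toHomeo (x + n, ⟨y, hCA hc⟩) = F.toHomeo p := by
      rw [F.toHomeo_lift_int]
      simp only [zsmul_eq_mul, mul_one] at hn
      exact Prod.ext (by simp [hn]) (Subtype.ext h2)
    rw [← F.toHomeo.injective hlift, periodic_int (periodic_annulusLift C) (x, _) n]
    exact hc
  · rw [mem_annulusLift, ← hF, ← hCinv]
    exact mem_image_of_mem Fq h

lemma isEssInvariant_annulusLift (F : AnnulusTwistMap)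
    {Fq : Circle1 × ℝ → Circle1 × ℝ}
    (hFq : ∀ p : ℝ × ℝ, Fq ((p.1 : Circle1), p.2) = (((F.f p).1 : Circle1), (F.f p).2))
    {γ : C(Circle1, AnnQ)}
    (hγ : ∀ c : AnnQ, ¬ ContinuousMap.Homotopic γ (ContinuousMap.const Circle1 c))
    (hCinv : Fq '' (Subtype.val '' range γ) = Subtype.val '' range γ) :
    IsEssInvariant F.toHomeo (annulusLift (Subtype.val '' range γ)) := by
  have hcoe := AddCircle.continuous_mk' (1 : ℝ)
  obtain ⟨ψ, hψ⟩ | ⟨X, hX, hXγ⟩ := circle_map_lift ⟨fun t => (γ t).1.1, by fun_prop⟩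
  · obtain ⟨c, hc⟩ := homotopic_const_of_lift hψ
    exact absurd hc (hγ c)
  have hmem (t : ℝ) (n : ℤ) :
      (X t + n, ⟨(γ t).1.2, (γ t).2⟩) ∈ annulusLift (Subtype.val '' range γ) := by
    rw [periodic_int (periodic_annulusLift _) (X t, _) n]
    exact ⟨γ t, mem_range_self _, Prod.ext (hXγ t).symm rfl⟩
  refine ⟨?_, ⟨_, hmem 0 0⟩, periodic_annulusLift _, ?_, ?_⟩
  · exact ((isCompact_range γ.continuous).image continuous_subtype_val).isClosed.preimage
      ((hcoe.comp continuous_fst).prodMk (continuous_subtype_val.comp continuous_snd))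
  · refine F.toHomeo_mem_annulusLift hFq ?_ hCinv
    rintro _ ⟨c, -, rfl⟩
    exact c.2
  · rintro ⟨x, y⟩ ⟨_, ⟨t, rfl⟩, ht⟩
    obtain ⟨t, rfl⟩ := QuotientAddGroup.mk_surjective t
    obtain ⟨h1, h2⟩ := Prod.ext_iff.1 ht
    have h3 : ((x - X t : ℝ) : Circle1) = 0 := by
      rw [AddCircle.coe_sub, sub_eq_zero, hXγ]
      exact h1.symm
    obtain ⟨n, hn⟩ := (AddCircle.coe_eq_zero_iff (1 : ℝ)).1 h3
    simp only [zsmul_eq_mul, mul_one] at hn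
    refine ⟨fun t => (X t + n, ⟨(γ t).1.2, (γ t).2⟩), by fun_prop, fun t => hmem t n,
      ⟨t, Prod.ext ?_ (Subtype.ext h2)⟩, fun s => ?_⟩
    · simp [hn]
    · obtain ⟨t, ht⟩ := hX (s - n)
      exact ⟨t, by simp [ht]⟩

/-- The lowest points of an invariant essential set form a periodic Lipschitz graph. -/
lemma IsEssInvariant.exists_lipschitz_graph {f : Strip ≃ₜ Strip} {C : Set Strip} {κ L : ℝ}
    (hC : IsEssInvariant f C) (hf : IsStripTwist f κ L) (hr : IsStripTwist (stripRev f) κ L) :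
    ∃ m : ℝ → unitInterval, (∀ x, (x, m x) ∈ C) ∧ Function.Periodic m 1 ∧
      ∀ x₁ x₂, |x₁ - x₂| ≤ 1 → |(m x₁ - m x₂ : ℝ)| ≤ L / κ * |x₁ - x₂| := by
  choose m hm hlow using hC.exists_lowest
  refine ⟨m, hm, fun x => le_antisymm ?_ ?_, fun x₁ x₂ h => ?_⟩
  · by_contra! hlt
    exact hlow _ _ hlt ((hC.periodic (x, m x)).2 (hm x))
  · by_contra! hlt
    exact hlow _ _ hlt ((hC.periodic (x, m (x + 1))).1 (hm (x + 1)))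
  · rcases lt_trichotomy x₁ x₂ with hlt | rfl | hlt
    · exact abs_sub_le_of_mem_lowerBoundary hf hr hC (p := (x₁, m x₁)) (q := (x₂, m x₂))
        ⟨hm _, hlow _⟩ ⟨hm _, hlow _⟩ hlt h
    · simp
    · rw [abs_sub_comm, abs_sub_comm x₁] at *
      exact abs_sub_le_of_mem_lowerBoundary hf hr hC (p := (x₂, m x₂)) (q := (x₁, m x₁))
        ⟨hm _, hlow _⟩ ⟨hm _, hlow _⟩ hlt h

lemma lipschitzWith_periodic_lift {m : ℝ → ℝ} (hper : Function.Periodic m 1) {K : ℝ}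
    (hm : ∀ x₁ x₂, |x₁ - x₂| ≤ 1 → |m x₁ - m x₂| ≤ K * |x₁ - x₂|) :
    LipschitzWith K.toNNReal (hper.lift : Circle1 → ℝ) := by
  refine LipschitzWith.of_dist_le' fun a b => ?_
  induction a using QuotientAddGroup.induction_on with
  | H x =>
  induction b using QuotientAddGroup.induction_on with
  | H y =>
  have h1 : dist (x : Circle1) y = |x - (y + round (x - y))| := by
    rw [dist_eq_norm, ← AddCircle.coe_sub, AddCircle.norm_eq]
    simp [sub_sub]
  have h2 : m y = m (y + round (x - y)) := by
    simpa using (hper.int_mul (round (x - y)) y).symm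
  have h3 : |x - (y + round (x - y))| ≤ 1 := by
    rw [← sub_sub]
    exact (abs_sub_round _).trans (by norm_num)
  rw [h1]
  change dist (m x) (m y) ≤ _
  rw [h2, Real.dist_eq]
  exact hm _ _ h3

/-- A simple closed curve containing a circle graph is equal to it. -/
lemma eq_graph_of_graph_subset {γ : C(Circle1, AnnQ)} (hγ : Function.Injective γ)
    {φ : Circle1 → ℝ} (hφ : Continuous φ) (h : ∀ x, (x, φ x) ∈ Subtype.val '' range γ) :
    Subtype.val '' range γ = {p : Circle1 × ℝ | p.2 = φ p.1} := by
  have h' (x : Circle1) : ∃ t, (γ t : Circle1 × ℝ) = (x, φ x) := by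
    obtain ⟨_, ⟨t, rfl⟩, ht⟩ := h x
    exact ⟨t, ht⟩
  choose g hg using h'
  have hgc : Continuous g := by
    rw [(γ.continuous.isClosedEmbedding hγ).isInducing.continuous_iff, continuous_induced_rng]
    refine (continuous_id.prodMk hφ).congr fun x => (hg x).symm
  have hginj : Function.Injective g := fun x y hxy => by
    have := hg x
    rw [hxy, hg] at this
    exact (congrArg Prod.fst this).symm
  apply Subset.antisymm
  · rintro _ ⟨_, ⟨t, rfl⟩, rfl⟩
    obtain ⟨x, rfl⟩ := surjective_of_injective_circle hgc hginj t
    rw [hg]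
    rfl
  · rintro ⟨x, y⟩ hy
    obtain rfl : y = φ x := hy
    exact h x

end Quotient

/-- **Birkhoff's graph theorem for invariant essential circles**: if `F` is the map of the
quotient annulus induced by `f`, and `C` is an `F`-invariant set which is the image of a
continuous injective loop in `𝕋¹ × [0,1]` that is not null-homotopic there, then `C` is
the graph of a Lipschitz function `φ : 𝕋¹ → [0,1]`. -/
theorem birkhoff_graph_theorem (F : AnnulusTwistMap)
    (Fq : Circle1 × ℝ → Circle1 × ℝ)
    (hFq : ∀ p : ℝ × ℝ, Fq ((p.1 : Circle1), p.2) = (((F.f p).1 : Circle1), (F.f p).2))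
    (γ : C(Circle1, ↥AnnQ)) (hγinj : Function.Injective γ)
    (hγnotnull : ∀ c : ↥AnnQ, ¬ ContinuousMap.Homotopic γ (ContinuousMap.const Circle1 c))
    (C : Set (Circle1 × ℝ)) (hC : C = Subtype.val '' Set.range γ)
    (hCinv : Fq '' C = C) :
    ∃ φ : Circle1 → ℝ, (∃ K, LipschitzWith K φ) ∧ (∀ x, φ x ∈ Set.Icc (0:ℝ) 1) ∧
      C = {p : Circle1 × ℝ | p.2 = φ p.1} := by
  subst hC
  obtain ⟨κ, L, hf, hr⟩ := F.exists_isStripTwist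
  obtain ⟨m, hmC, hmper, hmlip⟩ :=
    (isEssInvariant_annulusLift F hFq hγnotnull hCinv).exists_lipschitz_graph hf hr
  have hper : Function.Periodic (fun x => (m x : ℝ)) 1 := fun x => congrArg Subtype.val (hmper x)
  have hlip := lipschitzWith_periodic_lift hper hmlip
  refine ⟨hper.lift, ⟨_, hlip⟩, fun x => ?_,
    eq_graph_of_graph_subset hγinj hlip.continuous fun x => ?_⟩
  all_goals obtain ⟨x, rfl⟩ := QuotientAddGroup.mk_surjective x
  · exact (m x).2
  · exact hmC x
end
end

section
/- Existence of rotation number for monotone orbits: If the orbit of z ∈ A is monotone, i.e. the extended orbit EO(z) = {fⁿ(z) + (j,0) : n, j ∈ ℤ} is a monotone set, then the rotation number ρ(z) = lim_{n→∞} π_x(fⁿ(z))/n exists. -/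
open Set Filter Topology

noncomputable section

/-- The lift property extends from unit translations to all integer translations. -/
lemma AnnulusTwistMap.f_add_int (F : AnnulusTwistMap) {p : ℝ × ℝ} (hp : p ∈ Ann) (j : ℤ) :
    F.f (p + ((j : ℝ), 0)) = F.f p + ((j : ℝ), 0) := by
  have hAnn : ∀ k : ℤ, p + ((k : ℝ), 0) ∈ Ann := fun k => by simpa [Ann] using hp
  have hstep : ∀ k : ℤ,
      F.f (p + (((k + 1 : ℤ) : ℝ), 0)) = F.f (p + ((k : ℝ), 0)) + (1, 0) := fun k => by
    rw [← F.lift _ (hAnn k)]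
    congr 1
    ext <;> simp [add_assoc]
  induction j using Int.induction_on with
  | zero => simp [show ((0 : ℝ), (0 : ℝ)) = 0 from rfl]
  | succ k ih =>
    rw [hstep, ih]
    ext <;> simp [add_assoc]
  | pred k ih =>
    have h := hstep (-(k : ℤ) - 1)
    rw [sub_add_cancel, ih] at h
    rw [eq_sub_of_add_eq h.symm]
    ext <;> simp [sub_eq_add_neg, add_assoc]

lemma AnnulusTwistMap.iterate_mem_Ann (F : AnnulusTwistMap) {z : ℝ × ℝ} (hz : z ∈ Ann) (n : ℕ) :
    F.f^[n] z ∈ Ann :=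
  F.maps.iterate n hz

lemma iterate_add_int_mem_extOrbit (F : AnnulusTwistMap) (z : ℝ × ℝ) (n : ℕ) (j : ℤ) :
    F.f^[n] z + ((j : ℝ), 0) ∈ extOrbit F z :=
  ⟨n, j, by simp [iterZ]⟩

/-- On a monotone extended orbit, the horizontal order of integer translates of orbit points
is preserved under iteration. -/
lemma IsMonotoneSet.iterate_fst_add_int_lt {F : AnnulusTwistMap} {z : ℝ × ℝ} (hz : z ∈ Ann)
    (hmono : IsMonotoneSet F (extOrbit F z)) {a b : ℕ} {i j : ℤ}
    (h : (F.f^[a] z).1 + i < (F.f^[b] z).1 + j) (n : ℕ) :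
    (F.f^[a + n] z).1 + i < (F.f^[b + n] z).1 + j := by
  induction n with
  | zero => simpa using h
  | succ n ih =>
    have key := hmono _ (iterate_add_int_mem_extOrbit F z (a + n) i) _
      (iterate_add_int_mem_extOrbit F z (b + n) j) (by simpa using ih)
    rw [F.f_add_int (F.iterate_mem_Ann hz _), F.f_add_int (F.iterate_mem_Ann hz _),
      ← Function.iterate_succ_apply' F.f, ← Function.iterate_succ_apply' F.f] at key
    simpa [add_assoc] using key

/-- A real sequence whose additivity defect is bounded has a linear growth rate. -/
lemma exists_tendsto_div_of_abs_add_sub_le {u : ℕ → ℝ} {C : ℝ}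
    (hu : ∀ m n, |u (m + n) - u m - u n| ≤ C) :
    ∃ ω : ℝ, Tendsto (fun n : ℕ => u n / n) atTop (𝓝 ω) := by
  have hsub : Subadditive fun n => u n + C := fun m n => by
    linarith [(abs_le.1 (hu m n)).2]
  have hlow : ∀ n : ℕ, (n : ℝ) * (u 1 - C) ≤ u n + C := fun n => by
    induction n with
    | zero =>
      have h := (abs_le.1 (hu 0 0)).2
      simp only [add_zero] at h
      push_cast
      linarith
    | succ n ih =>
      push_cast
      linarith [(abs_le.1 (hu n 1)).1]
  have hbdd : BddBelow (range fun n : ℕ => (u n + C) / n) := by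
    refine ⟨min 0 (u 1 - C), ?_⟩
    rintro _ ⟨n, rfl⟩
    rcases n.eq_zero_or_pos with rfl | hn
    · simp
    · refine (min_le_right _ _).trans ?_
      rw [le_div_iff₀ (by exact_mod_cast hn), mul_comm]
      exact hlow n
  refine ⟨hsub.lim, ?_⟩
  have h := (hsub.tendsto_lim hbdd).sub (tendsto_const_div_atTop_nhds_zero_nat C)
  simpa [← sub_div] using h

/-- **Existence of the rotation number for monotone orbits**: if the extended orbit
`EO(z) = {fⁿ(z) + (j,0) : n, j ∈ ℤ}` of a point `z ∈ A` is a monotone set, then the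
rotation number `ρ(z) = lim_{n→∞} π_x(fⁿ(z))/n` exists. -/
theorem rotation_number_exists_of_monotone (F : AnnulusTwistMap)
    (z : ℝ × ℝ) (hz : z ∈ Ann)
    (hmono : IsMonotoneSet F (extOrbit F z)) :
    ∃ ω : ℝ, HasRotNum F z ω := by
  set x : ℕ → ℝ := fun n => (F.f^[n] z).1 with hx
  refine exists_tendsto_div_of_abs_add_sub_le (u := x) (C := 1 + |x 0|) fun m n => ?_
  have hup := hmono.iterate_fst_add_int_lt hz (a := m) (b := 0) (i := 0)
    (j := ⌊x m - x 0⌋ + 1) (by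
      push_cast
      linarith [Int.lt_floor_add_one (x m - x 0)]) n
  have hdown := hmono.iterate_fst_add_int_lt hz (a := 0) (b := m) (i := ⌈x m - x 0⌉ - 1)
    (j := 0) (by
      push_cast
      linarith [Int.ceil_lt_add_one (x m - x 0)]) n
  have hup' : x (m + n) < x n + (⌊x m - x 0⌋ + 1) := by simpa [hx] using hup
  have hdown' : x n + (⌈x m - x 0⌉ - 1) < x (m + n) := by simpa [hx] using hdown
  have hfloor := Int.floor_le (x m - x 0)
  have hceil := Int.le_ceil (x m - x 0)
  have hle := le_abs_self (x 0)
  have hge := neg_abs_le (x 0)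
  rw [abs_le]
  constructor <;> linarith
end
end
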